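/- The bifurcation set 𝓔 has Lebesgue measure zero and Hausdorff dimension dim_H(𝓔) = 1. -/

import Mathlib

open Set Filter MeasureTheory
open scoped ENNReal

/-- The Tanaka–Ito `α`-continued fraction map. -/
noncomputable def T (α x : ℝ) : ℝ := if x = 0 then 0 else 1 / x - (⌊1 / x + 1 - α⌋ : ℝ)

/-- `J` is a matching interval with matching exponents `(M, N)`. -/
def IsMatchingInterval (J : Set ℝ) (M N : ℕ) : Prop :=
  (∃ a b : ℝ, a < b ∧ J = Set.Ioo a b) ∧ J ⊆ Set.Icc 0 1 ∧
  (∀ α ∈ J, (T α)^[M] (α - 1) = (T α)^[N] α) ∧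
  (∀ᵐ α ∂(volume.restrict J), (T α)^[M - 1] (α - 1) ≠ (T α)^[N - 1] α) ∧
  (∀ J' : Set ℝ, (∃ a b : ℝ, a < b ∧ J' = Set.Ioo a b) → J' ⊆ Set.Icc 0 1 →
    (∀ α ∈ J', (T α)^[M] (α - 1) = (T α)^[N] α) →
    (∀ᵐ α ∂(volume.restrict J'), (T α)^[M - 1] (α - 1) ≠ (T α)^[N - 1] α) →
    J ⊆ J' → J' = J)

/-- The matching set: the union of all matching intervals. -/
def MatchingSet : Set ℝ := {x | ∃ (J : Set ℝ) (M N : ℕ), IsMatchingInterval J M N ∧ x ∈ J}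

/-- The bifurcation set `𝓔`: the complement in `[0,1]` of the matching set. -/
def E : Set ℝ := Set.Icc 0 1 \ MatchingSet

namespace TanakaIto

section Basic

variable {α x y z : ℝ}

lemma T_eq_of_mem (hx : x ≠ 0) (hz : z ∈ Ico (α - 1) α) (k : ℤ) (h : 1 / x = z + k) :
    T α x = z := by
  have hf : ⌊1 / x + 1 - α⌋ = k := by
    rw [Int.floor_eq_iff, h]
    constructor <;> linarith [hz.1, hz.2]
  rw [T, if_neg hx, hf, h]
  ring

lemma T_spec (hx : x ≠ 0) : ∃ k : ℤ, 1 / x = T α x + k :=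
  ⟨⌊1 / x + 1 - α⌋, by rw [T, if_neg hx]; ring⟩

lemma T_mem (hx : x ≠ 0) : T α x ∈ Ico (α - 1) α := by
  rw [T, if_neg hx]
  have h1 := Int.floor_le (1 / x + 1 - α)
  have h2 := Int.lt_floor_add_one (1 / x + 1 - α)
  constructor <;> linarith

lemma T_congr (hx : x ≠ 0) (hy : y ≠ 0) (k : ℤ) (h : 1 / x = 1 / y + k) : T α x = T α y := by
  obtain ⟨l, hl⟩ := T_spec (α := α) hy
  exact T_eq_of_mem hx (T_mem hy) (l + k) (by push_cast; rw [h, hl]; ring)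

/-- Away from the left endpoint, `T` is conjugated to itself by `x ↦ -x` and `α ↦ 1 - α`. -/
lemma T_neg (hx : x ≠ 0) (h : T α x ≠ α - 1) : T (1 - α) (-x) = -T α x := by
  obtain ⟨k, hk⟩ := T_spec (α := α) hx
  obtain ⟨h1, h2⟩ := T_mem (α := α) hx
  refine T_eq_of_mem (neg_ne_zero.2 hx) ⟨by linarith, ?_⟩ (-k) ?_
  · have := lt_of_le_of_ne h1 h.symm
    linarith
  · push_cast
    rw [div_neg, hk]
    ring

end Basic

section Nonquadratic

/-- `α` is not a root of a non-zero integer polynomial of degree at most two. -/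
def NonQuadratic (α : ℝ) : Prop :=
  ∀ a b c : ℤ, (a : ℝ) * α ^ 2 + b * α + c = 0 → a = 0 ∧ b = 0 ∧ c = 0

variable {α : ℝ}

lemma countable_not_nonQuadratic : {α : ℝ | ¬ NonQuadratic α}.Countable := by
  refine (Algebraic.countable ℤ ℝ).mono fun α h => ?_
  simp only [NonQuadratic, mem_ofPred_eq, not_forall] at h
  obtain ⟨a, b, c, h, hne⟩ := h
  refine ⟨Polynomial.C a * Polynomial.X ^ 2 + Polynomial.C b * Polynomial.X + Polynomial.C c,
    fun h0 => hne ?_, by simpa using h⟩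
  have e (n : ℕ) := congrArg (fun p => Polynomial.coeff p n) h0
  have e0 := e 0
  have e1 := e 1
  have e2 := e 2
  simp [Polynomial.coeff_X, Polynomial.coeff_C, -eq_intCast] at e0 e1 e2
  exact ⟨e2, e1, e0⟩

lemma NonQuadratic.one_sub (h : NonQuadratic α) : NonQuadratic (1 - α) := by
  intro a b c habc
  have := h a (-2 * a - b) (a + b + c) (by push_cast; linear_combination habc)
  omega

lemma NonQuadratic.linear (h : NonQuadratic α) {a b : ℤ} (hab : (a : ℝ) * α + b = 0) :
    a = 0 ∧ b = 0 :=
  (h 0 a b (by push_cast; linear_combination hab)).2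

lemma NonQuadratic.irrational (h : NonQuadratic α) : Irrational α := by
  rintro ⟨q, hq⟩
  have hd : (q.den : ℝ) ≠ 0 := by exact_mod_cast q.den_nz
  have h2 : (q.num : ℝ) / q.den = α := by rw [← hq]; exact_mod_cast Rat.num_div_den q
  have := h.linear (a := q.den) (b := -q.num) (by push_cast; rw [← h2]; field_simp; ring)
  exact q.den_nz (by exact_mod_cast this.1)

lemma NonQuadratic.add_ne_zero (h : NonQuadratic α) {a b c d : ℤ}
    (hdet : (a * d - b * c) ^ 2 = 1) : (a : ℝ) * α + b ≠ 0 ∧ (c : ℝ) * α + d ≠ 0 := by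
  constructor <;>
  · intro h0
    obtain ⟨rfl, rfl⟩ := h.linear h0
    simp at hdet

/-- An integer Möbius transformation of determinant `±1` is determined, up to sign, by its value
at a real number that is neither rational nor quadratic. -/
lemma NonQuadratic.moebius_unique (h : NonQuadratic α) {a b c d a' b' c' d' : ℤ}
    (hdet : (a * d - b * c) ^ 2 = 1) (hdet' : (a' * d' - b' * c') ^ 2 = 1)
    (heq : ((a : ℝ) * α + b) / (c * α + d) = (a' * α + b') / (c' * α + d')) :
    ∃ e : ℤ, e ^ 2 = 1 ∧ a' = e * a ∧ b' = e * b ∧ c' = e * c ∧ d' = e * d := by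
  have h1 := (h.add_ne_zero hdet).2
  have h2 := (h.add_ne_zero hdet').2
  rw [div_eq_div_iff h1 h2] at heq
  obtain ⟨e1, e2, e3⟩ := h (a * c' - a' * c) (a * d' + b * c' - a' * d - b' * c) (b * d' - b' * d)
    (by push_cast; linear_combination heq)
  refine ⟨(a * d - b * c) * (d * a' - b * c'), ?_, ?_, ?_, ?_, ?_⟩
  · have key : (d * a' - b * c') ^ 2 = (a * d - b * c) * (a' * d' - b' * c') := by
      linear_combination (b * c' - d * a') * e2 - (b * d' - b' * d) * e1
    have h4 : (d * a' - b * c') ^ 2 * (d * a' - b * c') ^ 2 = 1 := by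
      rw [key]
      linear_combination (a' * d' - b' * c') ^ 2 * hdet + hdet'
    rw [mul_pow, hdet, one_mul]
    nlinarith [sq_nonneg ((d * a' - b * c') ^ 2), sq_nonneg (d * a' - b * c')]
  · linear_combination (-a') * hdet + (a * d - b * c) * b * e1
  · linear_combination (-b') * hdet + (a * d - b * c) * (b * e2 - a * e3)
  · linear_combination (-c') * hdet + (a * d - b * c) * d * e1
  · linear_combination (-d') * hdet + (a * d - b * c) * (d * e2 - c * e3)

end Nonquadratic

section Orbit

open scoped Topology

variable {α : ℝ} {e : ℤ}

/-- The product of the absolute values of the first `n` points of the orbit of `x` under `T α`. -/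
noncomputable def orbitProd (α x : ℝ) (n : ℕ) : ℝ := ∏ i ∈ Finset.range n, |(T α)^[i] x|

lemma orbitProd_succ (α x : ℝ) (n : ℕ) :
    orbitProd α x (n + 1) = orbitProd α x n * |(T α)^[n] x| := Finset.prod_range_succ _ _

/-- Near the parameter `α` the orbit of `t - e` is given by one integer Möbius transformation. -/
def LocalMoebius (α : ℝ) (e : ℤ) (n : ℕ) : Prop :=
  ∃ a b c d : ℤ, (a * d - b * c) ^ 2 = 1 ∧ |(c : ℝ) * α + d| = orbitProd α (α - e) n ∧
    ∀ᶠ t in 𝓝 α, (T t)^[n] (t - e) = (a * t + b) / (c * t + d)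

lemma LocalMoebius.zero (α : ℝ) (e : ℤ) : LocalMoebius α e 0 :=
  ⟨1, -e, 0, 1, by ring, by simp [orbitProd], Eventually.of_forall fun t => by simp; ring⟩

lemma LocalMoebius.ne_zero (hα : NonQuadratic α) {n : ℕ} (h : LocalMoebius α e n) :
    (T α)^[n] (α - e) ≠ 0 := by
  obtain ⟨a, b, c, d, hdet, -, hloc⟩ := h
  rw [hloc.self_of_nhds]
  exact div_ne_zero (hα.add_ne_zero hdet).1 (hα.add_ne_zero hdet).2

lemma LocalMoebius.succ (hα : NonQuadratic α) {n : ℕ} (h : LocalMoebius α e n)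
    (hprod : orbitProd α (α - e) (n + 1) < 1) :
    (T α)^[n + 1] (α - e) ∈ Ioo (α - 1) α ∧ LocalMoebius α e (n + 1) := by
  have hx := h.ne_zero hα
  obtain ⟨a, b, c, d, hdet, habs, hloc⟩ := h
  obtain ⟨h1, h2⟩ := hα.add_ne_zero hdet
  have hval := hloc.self_of_nhds
  set x := (T α)^[n] (α - e) with hxdef
  obtain ⟨k, hk⟩ := T_spec (α := α) hx
  have hdet' : (c - k * a) * b - (d - k * b) * a = -(a * d - b * c) := by ring
  have hmem := T_mem (α := α) hx
  have hT : T α x = (((c - k * a : ℤ) : ℝ) * α + (d - k * b : ℤ)) / (a * α + b) := by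
    have : T α x = 1 / x - k := by linarith
    rw [this, hval]
    push_cast
    field_simp
    ring
  have habs' : |(a : ℝ) * α + b| = orbitProd α (α - e) (n + 1) := by
    rw [orbitProd_succ, ← habs, ← hxdef, hval, abs_div, mul_div_cancel₀ _ (abs_ne_zero.2 h2)]
  have hne : T α x ≠ α - 1 := by
    intro heq
    obtain ⟨s, hs, -, -, e3, e4⟩ := hα.moebius_unique (a := 1) (b := -1) (c := 0) (d := 1)
      (a' := c - k * a) (b' := d - k * b) (c' := a) (d' := b) (by norm_num)
      (by rw [hdet', neg_sq, hdet]) (by rw [← hT, heq]; push_cast; ring)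
    rw [← habs', e3, e4] at hprod
    have hs1 : ((s : ℝ)) ^ 2 = 1 := by exact_mod_cast hs
    have : |(s : ℝ)| = 1 := by rw [← sq_eq_sq₀ (abs_nonneg _) zero_le_one, sq_abs, hs1, one_pow]
    push_cast at hprod
    simp [this] at hprod
  have hio : T α x ∈ Ioo (α - 1) α := ⟨lt_of_le_of_ne hmem.1 hne.symm, hmem.2⟩
  rw [LocalMoebius, Function.iterate_succ_apply', ← hxdef]
  refine ⟨hio, c - k * a, d - k * b, a, b, by rw [hdet', neg_sq, hdet], habs', ?_⟩
  have hc1 : ContinuousAt (fun t : ℝ => (a : ℝ) * t + b) α := by fun_prop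
  have hc2 : ContinuousAt (fun t : ℝ => (((c - k * a : ℤ) : ℝ) * t + (d - k * b : ℤ)) /
      (a * t + b)) α := ContinuousAt.div (by fun_prop) (by fun_prop) h1
  have hc3 : ContinuousAt (fun t : ℝ => (c : ℝ) * t + d) α := by fun_prop
  rw [hT] at hio
  have e1 := (continuousAt_id.sub continuousAt_const : ContinuousAt (fun t : ℝ => t - 1) α).eventually_lt
    hc2 hio.1
  have e2 := hc2.eventually_lt continuousAt_id hio.2
  filter_upwards [hloc, hc1.eventually_ne h1, hc3.eventually_ne h2, e1, e2] with t ht t1 t2 t3 t4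
  rw [Function.iterate_succ_apply', ht]
  refine T_eq_of_mem (div_ne_zero t1 t2) ⟨t3.le, t4⟩ k ?_
  push_cast
  field_simp
  ring

lemma orbit_aux (hα : NonQuadratic α) (h0 : 0 < α) (h1 : α < 1) (he : e = 0 ∨ e = 1) (n : ℕ) :
    LocalMoebius α e n ∧ |(T α)^[n] (α - e)| < 1 ∧ 0 < orbitProd α (α - e) n ∧
      orbitProd α (α - e) n ≤ 1 := by
  induction n with
  | zero =>
    refine ⟨.zero α e, ?_, by simp [orbitProd], by simp [orbitProd]⟩
    rcases he with rfl | rfl <;> simp [abs_lt] <;> constructor <;> linarith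
  | succ n ih =>
    obtain ⟨ih1, ih2, ih3, ih4⟩ := ih
    have hx := abs_pos.2 (ih1.ne_zero hα)
    have hp : orbitProd α (α - e) (n + 1) < 1 := by rw [orbitProd_succ]; nlinarith
    obtain ⟨h2, h3⟩ := ih1.succ hα hp
    refine ⟨h3, ?_, by rw [orbitProd_succ]; positivity, hp.le⟩
    rw [abs_lt]
    constructor <;> linarith [h2.1, h2.2]

lemma orbit_mem_Ioo (hα : NonQuadratic α) (h0 : 0 < α) (h1 : α < 1) (he : e = 0 ∨ e = 1)
    (n : ℕ) : (T α)^[n + 1] (α - e) ∈ Ioo (α - 1) α := by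
  obtain ⟨h2, h3, h4, h5⟩ := orbit_aux hα h0 h1 he n
  refine (h2.succ hα ?_).1
  rw [orbitProd_succ]
  nlinarith [abs_nonneg ((T α)^[n] (α - e))]

lemma orbitProd_strictAnti (hα : NonQuadratic α) (h0 : 0 < α) (h1 : α < 1)
    (he : e = 0 ∨ e = 1) : StrictAnti (orbitProd α (α - e)) := by
  refine strictAnti_nat_of_succ_lt fun n => ?_
  obtain ⟨-, h3, h4, -⟩ := orbit_aux hα h0 h1 he n
  rw [orbitProd_succ]
  nlinarith

lemma LocalMoebius.irrational (hα : NonQuadratic α) {n : ℕ} (h : LocalMoebius α e n) :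
    Irrational ((T α)^[n] (α - e)) := by
  obtain ⟨a, b, c, d, hdet, -, hloc⟩ := h
  obtain ⟨-, h2⟩ := hα.add_ne_zero hdet
  rintro ⟨q, hq⟩
  rw [hloc.self_of_nhds, eq_div_iff h2] at hq
  have hd : (q.den : ℝ) ≠ 0 := by exact_mod_cast q.den_nz
  have hq2 : (q : ℝ) * q.den = q.num := by exact_mod_cast Rat.mul_den_eq_num q
  obtain ⟨e1, e2⟩ := hα.linear (a := q.num * c - q.den * a) (b := q.num * d - q.den * b) (by
    push_cast; rw [← hq2]; linear_combination (q.den : ℝ) * hq)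
  have : (q.den : ℤ) * (a * d - b * c) = 0 := by linear_combination c * e2 - d * e1
  rcases mul_eq_zero.1 this with h | h
  · exact q.den_nz (by exact_mod_cast h)
  · simp [h] at hdet

/-- If two orbits add up to an integer or coincide, then their denominators agree. -/
lemma orbitProd_eq_of_int (hα : NonQuadratic α) {e' : ℤ} {n m : ℕ} (h : LocalMoebius α e n)
    (h' : LocalMoebius α e' m) (s : ℤ) (hs : s ^ 2 = 1) (j : ℤ)
    (heq : (T α)^[m] (α - e') = s * (T α)^[n] (α - e) + j) :
    orbitProd α (α - e') m = orbitProd α (α - e) n := by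
  obtain ⟨a, b, c, d, hdet, habs, hloc⟩ := h
  obtain ⟨a', b', c', d', hdet', habs', hloc'⟩ := h'
  have h2 := (hα.add_ne_zero hdet).2
  rw [hloc.self_of_nhds, hloc'.self_of_nhds] at heq
  obtain ⟨r, hr, -, -, e3, e4⟩ := hα.moebius_unique (a := s * a + j * c) (b := s * b + j * d)
    (c := c) (d := d) (by linear_combination s ^ 2 * hdet + hs) hdet' (by
      rw [heq]; push_cast; field_simp; ring)
  rw [← habs', ← habs, e3, e4]
  have : |(r : ℝ)| = 1 := by
    rw [← sq_eq_sq₀ (abs_nonneg _) zero_le_one, sq_abs]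
    exact_mod_cast hr
  push_cast
  rw [show (r : ℝ) * c * α + r * d = r * (c * α + d) by ring, abs_mul, this, one_mul]

lemma LocalMoebius.eventually_eq (hα : NonQuadratic α) {e' : ℤ} {n m : ℕ}
    (h : LocalMoebius α e n) (h' : LocalMoebius α e' m)
    (heq : (T α)^[n] (α - e) = (T α)^[m] (α - e')) :
    ∀ᶠ t in 𝓝 α, (T t)^[n] (t - e) = (T t)^[m] (t - e') := by
  obtain ⟨a, b, c, d, hdet, -, hloc⟩ := h
  obtain ⟨a', b', c', d', hdet', -, hloc'⟩ := h'
  rw [hloc.self_of_nhds, hloc'.self_of_nhds] at heq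
  obtain ⟨r, hr, e1, e2, e3, e4⟩ := hα.moebius_unique hdet hdet' heq
  have hr0 : (r : ℝ) ≠ 0 := by rintro h; simp [Int.cast_eq_zero.1 h] at hr
  filter_upwards [hloc, hloc'] with t ht ht'
  rw [ht, ht', e1, e2, e3, e4]
  push_cast
  rw [show (r : ℝ) * a * t + r * b = r * (a * t + b) by ring,
    show (r : ℝ) * c * t + r * d = r * (c * t + d) by ring, mul_div_mul_left _ _ hr0]

lemma LocalMoebius.continuousAt (hα : NonQuadratic α) {n : ℕ} (h : LocalMoebius α e n) :
    ContinuousAt (fun t => (T t)^[n] (t - e)) α := by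
  obtain ⟨a, b, c, d, hdet, -, hloc⟩ := h
  refine ContinuousAt.congr ?_ (hloc.mono fun t ht => ht.symm)
  exact ContinuousAt.div (by fun_prop) (by fun_prop) (hα.add_ne_zero hdet).2

end Orbit

section Matching

open scoped Topology

variable {α : ℝ}

/-- The conditions on a matching interval, except for its maximality. -/
def IsPrematching (J : Set ℝ) (M N : ℕ) : Prop :=
  (∃ a b : ℝ, a < b ∧ J = Ioo a b) ∧ J ⊆ Icc 0 1 ∧
    (∀ t ∈ J, (T t)^[M] (t - 1) = (T t)^[N] t) ∧
    ∀ᵐ t ∂(volume.restrict J), (T t)^[M - 1] (t - 1) ≠ (T t)^[N - 1] t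

lemma isOpen_eq_Ioo {U : Set ℝ} (ho : IsOpen U) (hc : OrdConnected U) (hne : U.Nonempty)
    (hb : U ⊆ Icc 0 1) : ∃ a b : ℝ, a < b ∧ U = Ioo a b := by
  have hbb : BddBelow U := ⟨0, fun x hx => (hb hx).1⟩
  have hba : BddAbove U := ⟨1, fun x hx => (hb hx).2⟩
  have hsub : Ioo (sInf U) (sSup U) ⊆ U :=
    IsConnected.Ioo_csInf_csSup_subset ⟨hne, isPreconnected_iff_ordConnected.2 hc⟩ hbb hba
  have hsup : U ⊆ Ioo (sInf U) (sSup U) := by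
    intro x hx
    obtain ⟨ε, hε, h⟩ := Metric.isOpen_iff.1 ho x hx
    rw [Real.ball_eq_Ioo] at h
    have h1 := csInf_le hbb (h (show x - ε / 2 ∈ _ from ⟨by linarith, by linarith⟩))
    have h2 := le_csSup hba (h (show x + ε / 2 ∈ _ from ⟨by linarith, by linarith⟩))
    exact ⟨by linarith, by linarith⟩
  obtain ⟨x, hx⟩ := hne
  exact ⟨_, _, (hsup hx).1.trans (hsup hx).2, hsup.antisymm hsub⟩

lemma IsPrematching.mem_matchingSet {J : Set ℝ} {M N : ℕ} (h : IsPrematching J M N)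
    (hα : α ∈ J) : α ∈ MatchingSet := by
  set S := {K | IsPrematching K M N ∧ α ∈ K} with hS
  have hopen : ∀ K ∈ S, IsOpen K := by
    rintro K ⟨⟨⟨a, b, -, rfl⟩, -⟩, -⟩
    exact isOpen_Ioo
  have hsub : ⋃₀ S ⊆ Icc 0 1 := sUnion_subset fun K hK => hK.1.2.1
  have hJ : J ⊆ ⋃₀ S := subset_sUnion_of_mem ⟨h, hα⟩
  have hconn : OrdConnected (⋃₀ S) := by
    rw [← isPreconnected_iff_ordConnected]
    refine isPreconnected_sUnion α S (fun K hK => hK.2) ?_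
    rintro K ⟨⟨⟨a, b, -, rfl⟩, -⟩, -⟩
    exact isPreconnected_Ioo
  have hae : ∀ᵐ t ∂(volume.restrict (⋃₀ S)), (T t)^[M - 1] (t - 1) ≠ (T t)^[N - 1] t := by
    rw [ae_restrict_iff' (isOpen_sUnion hopen).measurableSet, ae_iff]
    refine measure_null_of_locally_null _ fun x hx => ?_
    simp only [mem_ofPred_eq, Classical.not_imp] at hx
    obtain ⟨⟨K, hK, hxK⟩, -⟩ := hx
    have hKae := hK.1.2.2.2
    rw [ae_restrict_iff' (hopen K hK).measurableSet, ae_iff] at hKae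
    refine ⟨_ ∩ K, inter_mem self_mem_nhdsWithin
      (mem_nhdsWithin_of_mem_nhds ((hopen K hK).mem_nhds hxK)),
      measure_mono_null (fun t ht => ?_) hKae⟩
    simp only [mem_inter_iff, mem_ofPred_eq, Classical.not_imp] at ht ⊢
    exact ⟨ht.2, ht.1.2⟩
  refine ⟨⋃₀ S, M, N, ⟨isOpen_eq_Ioo (isOpen_sUnion hopen) hconn ⟨α, hJ hα⟩ hsub, hsub, ?_, hae,
    fun K h1 h2 h3 h4 h5 => ?_⟩, hJ hα⟩
  · rintro t ⟨K, hK, htK⟩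
    exact hK.1.2.2.1 t htK
  · have hK : K ∈ S := ⟨⟨h1, h2, h3, h4⟩, h5 (hJ hα)⟩
    exact (subset_sUnion_of_mem hK).antisymm h5

/-- The orbits of the two endpoints meet. -/
def Merges (α : ℝ) : Prop := ∃ M N : ℕ, (T α)^[M] (α - 1) = (T α)^[N] α

lemma Merges.of_mem_matchingSet (h : α ∈ MatchingSet) : Merges α := by
  obtain ⟨J, M, N, hJ, hα⟩ := h
  exact ⟨M, N, hJ.2.2.1 α hα⟩

lemma localMoebius_left (hα : NonQuadratic α) (h0 : 0 < α) (h1 : α < 1) (n : ℕ) :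
    LocalMoebius α 1 n := (orbit_aux hα h0 h1 (.inr rfl) n).1

lemma localMoebius_right (hα : NonQuadratic α) (h0 : 0 < α) (h1 : α < 1) (n : ℕ) :
    LocalMoebius α 0 n := (orbit_aux hα h0 h1 (.inl rfl) n).1

lemma left_mem_Ioo (hα : NonQuadratic α) (h0 : 0 < α) (h1 : α < 1) (n : ℕ) :
    (T α)^[n + 1] (α - 1) ∈ Ioo (α - 1) α := by
  simpa using orbit_mem_Ioo hα h0 h1 (.inr rfl) n

lemma right_mem_Ioo (hα : NonQuadratic α) (h0 : 0 < α) (h1 : α < 1) (n : ℕ) :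
    (T α)^[n + 1] α ∈ Ioo (α - 1) α := by
  simpa using orbit_mem_Ioo hα h0 h1 (.inl rfl) n

lemma left_irrational (hα : NonQuadratic α) (h0 : 0 < α) (h1 : α < 1) (n : ℕ) :
    Irrational ((T α)^[n] (α - 1)) := by
  simpa using (localMoebius_left hα h0 h1 n).irrational hα

lemma right_irrational (hα : NonQuadratic α) (h0 : 0 < α) (h1 : α < 1) (n : ℕ) :
    Irrational ((T α)^[n] α) := by
  simpa using (localMoebius_right hα h0 h1 n).irrational hα

lemma Merges.mem_matchingSet (hα : NonQuadratic α) (h0 : 0 < α) (h1 : α < 1) (h : Merges α) :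
    α ∈ MatchingSet := by
  obtain ⟨M, N, hMN, hpred⟩ : ∃ M N : ℕ, (T α)^[M + 1] (α - 1) = (T α)^[N + 1] α ∧
      (T α)^[M] (α - 1) ≠ (T α)^[N] α := by
    obtain ⟨M, N, h⟩ := h
    induction M generalizing N with
    | zero =>
      cases N with
      | zero => simp at h
      | succ N => exact absurd h (right_mem_Ioo hα h0 h1 N).1.ne
    | succ M ih =>
      cases N with
      | zero => exact absurd h (left_mem_Ioo hα h0 h1 M).2.ne
      | succ N =>
        by_cases hc : (T α)^[M] (α - 1) = (T α)^[N] α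
        · exact ih N hc
        · exact ⟨M, N, h, hc⟩
  have hl := localMoebius_left hα h0 h1
  have hr := localMoebius_right hα h0 h1
  have e1 := (hl (M + 1)).eventually_eq hα (hr (N + 1)) (by simpa using hMN)
  have e2 : ∀ᶠ t in 𝓝 α, (T t)^[M] (t - 1) ≠ (T t)^[N] t := by
    have c1 := (hl M).continuousAt hα
    have c2 := (hr N).continuousAt hα
    simp only [Int.cast_one, Int.cast_zero, sub_zero] at c1 c2
    filter_upwards [(c1.sub c2).eventually_ne (sub_ne_zero.2 hpred)] with t ht
    exact sub_ne_zero.1 ht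
  obtain ⟨a, b, hab, hsub⟩ := mem_nhds_iff_exists_Ioo_subset.1
    ((e1.and e2).and (Ioo_mem_nhds h0 h1))
  have hJ : IsPrematching (Ioo a b) (M + 1) (N + 1) := by
    refine ⟨⟨a, b, hab.1.trans hab.2, rfl⟩, fun t ht => Ioo_subset_Icc_self (hsub ht).2,
      fun t ht => by simpa using (hsub ht).1.1, ?_⟩
    filter_upwards [ae_restrict_mem measurableSet_Ioo] with t ht
    exact (hsub ht).1.2
  exact hJ.mem_matchingSet hab

lemma iterate_T_one_sub (hα : NonQuadratic α) (h0 : 0 < α) (h1 : α < 1) {e : ℤ}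
    (he : e = 0 ∨ e = 1) (n : ℕ) : (T (1 - α))^[n] (-(α - e)) = -(T α)^[n] (α - e) := by
  induction n with
  | zero => simp
  | succ n ih =>
    have := orbit_mem_Ioo hα h0 h1 he n
    rw [Function.iterate_succ_apply'] at this
    rw [Function.iterate_succ_apply', ih, Function.iterate_succ_apply',
      T_neg ((orbit_aux hα h0 h1 he n).1.ne_zero hα) this.1.ne']

lemma Merges.one_sub (hα : NonQuadratic α) (h0 : 0 < α) (h1 : α < 1) (h : Merges α) :
    Merges (1 - α) := by
  obtain ⟨M, N, h⟩ := h
  refine ⟨N, M, ?_⟩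
  have e1 := iterate_T_one_sub hα h0 h1 (e := 0) (.inl rfl) N
  have e2 := iterate_T_one_sub hα h0 h1 (e := 1) (.inr rfl) M
  simp only [Int.cast_zero, sub_zero, Int.cast_one, neg_sub] at e1 e2
  rw [show 1 - α - 1 = -α by ring, e1, e2, h]

end Matching

section Dynamics

/-- The Gauss map. -/
noncomputable def gauss (x : ℝ) : ℝ := Int.fract (1 / x)

variable {β x y v : ℝ}

lemma gauss_spec (v : ℝ) : ∃ k : ℤ, 1 / v = gauss v + k :=
  ⟨⌊1 / v⌋, by rw [gauss, Int.fract]; ring⟩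

lemma gauss_eq_of_mem {z : ℝ} (hz : z ∈ Ico (0 : ℝ) 1) (k : ℤ) (h : 1 / v = z + k) :
    gauss v = z := by
  rw [gauss, h, Int.fract_add_intCast, Int.fract_eq_self.2 hz]

lemma gauss_irrational (hv : Irrational v) : Irrational (gauss v) := by
  rw [gauss, Int.fract]
  exact (by simpa using hv.inv : Irrational (1 / v)).sub_intCast _

lemma gauss_mem_Ioo (hv : Irrational v) : gauss v ∈ Ioo (0 : ℝ) 1 :=
  ⟨lt_of_le_of_ne (Int.fract_nonneg _) (gauss_irrational hv).ne_zero.symm, Int.fract_lt_one _⟩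

lemma gauss_iterate_irrational (hv : Irrational v) (n : ℕ) : Irrational (gauss^[n] v) := by
  induction n with
  | zero => exact hv
  | succ n ih => rw [Function.iterate_succ_apply']; exact gauss_irrational ih

/-- The image of `x` is determined up to sign and integers. -/
lemma T_eq_gauss {α : ℝ} (hx : x ≠ 0) (s k : ℤ) (h : 1 / x = s * (1 / v) + k) :
    ∃ i : ℤ, T α x = s * gauss v + i := by
  obtain ⟨a, ha⟩ := T_spec (α := α) hx
  obtain ⟨b, hb⟩ := gauss_spec v
  refine ⟨s * b + k - a, ?_⟩
  push_cast
  rw [hb] at h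
  linear_combination h - ha

lemma T_add_T {α : ℝ} (hx : x ≠ 0) (hy : y ≠ 0) (k : ℤ) (h : 1 / x + 1 / y = k) :
    ∃ j : ℤ, T α x + T α y = j := by
  obtain ⟨a, ha⟩ := T_spec (α := α) hx
  obtain ⟨b, hb⟩ := T_spec (α := α) hy
  exact ⟨k - a - b, by push_cast; linear_combination h - ha - hb⟩

/-- The right endpoint of the interval that starts at `β` and in which the orbits meet. -/
noncomputable def hole (β : ℝ) : ℝ := (1 - β) / (2 - β)

lemma T_T_one_sub_eq (h0 : 0 < β) (hq : 0 < β ^ 2 - 3 * β + 1) (h2 : β < 1 / 2)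
    (hx0 : 0 < x) (hx : x < hole β) :
    T (1 - β) (T (1 - β) (1 - x)) = T (1 - β) x := by
  rw [hole, lt_div_iff₀ (by linarith)] at hx
  have hx1 : x < 1 := by nlinarith
  have h3 : (0 : ℝ) < 1 - x := by linarith
  have e : T (1 - β) (1 - x) = x / (1 - x) := by
    refine T_eq_of_mem h3.ne' ⟨?_, ?_⟩ 1 (by push_cast; field_simp; ring)
    · have : 0 < x / (1 - x) := by positivity
      linarith
    · rw [div_lt_iff₀ h3]
      nlinarith
  rw [e]
  exact T_congr (by positivity) hx0.ne' (-1) (by push_cast; field_simp; ring)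

lemma T_center (h0 : 0 < β) (hq : 0 < β ^ 2 - 3 * β + 1) (h2 : β < 1 / 2)
    (hx : hole β ≤ x) (hx2 : x < 1 / 2) :
    T (1 - β) x = 1 / x - 2 ∧ T (1 - β) (1 - x) = 1 / (1 - x) - 2 := by
  rw [hole, div_le_iff₀ (by linarith)] at hx
  have hx0 : 0 < x := by nlinarith
  have h3 : (0 : ℝ) < 1 - x := by linarith
  constructor
  · refine T_eq_of_mem hx0.ne' ⟨?_, ?_⟩ 2 (by push_cast; ring)
    · have : 2 < 1 / x := by rw [lt_div_iff₀ hx0]; linarith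
      linarith
    · have : 1 / x < 3 - β := by
        rw [div_lt_iff₀ hx0]
        by_contra! hcon
        have e1 : (1 - β) * (3 - β) ≤ x * (2 - β) * (3 - β) :=
          mul_le_mul_of_nonneg_right hx (by linarith)
        have e2 : ((3 - β) * x) * (2 - β) ≤ 1 * (2 - β) :=
          mul_le_mul_of_nonneg_right hcon (by linarith)
        nlinarith
      linarith
  · refine T_eq_of_mem h3.ne' ⟨?_, ?_⟩ 2 (by push_cast; ring)
    · have : 2 - β ≤ 1 / (1 - x) := by
        rw [le_div_iff₀ h3]
        nlinarith
      linarith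
    · have : 1 / (1 - x) < 2 := by
        rw [div_lt_iff₀ h3]
        linarith
      linarith

lemma gauss_sub_one (h0 : 1 / 2 < v) (h1 : v < 1) : gauss v = 1 / v - 1 := by
  refine gauss_eq_of_mem ⟨?_, ?_⟩ 1 (by push_cast; ring)
  · have : 1 ≤ 1 / v := by rw [le_div_iff₀ (by linarith)]; linarith
    linarith
  · have : 1 / v < 2 := by rw [div_lt_iff₀ (by linarith)]; linarith
    linarith

lemma gauss_sub_two (h0 : 1 / 3 < v) (h1 : v ≤ 1 / 2) : gauss v = 1 / v - 2 := by
  refine gauss_eq_of_mem ⟨?_, ?_⟩ 2 (by push_cast; ring)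
  · have : 2 ≤ 1 / v := by rw [le_div_iff₀ (by linarith)]; linarith
    linarith
  · have : 1 / v < 3 := by rw [div_lt_iff₀ (by linarith)]; linarith
    linarith

lemma hole_lt_half (h0 : 0 < β) (h2 : β < 1 / 2) : hole β < 1 / 2 := by
  rw [hole, div_lt_iff₀ (by linarith)]; linarith

lemma third_lt_hole (h2 : β < 1 / 2) : 1 / 3 < hole β := by
  rw [hole, lt_div_iff₀ (by linarith)]; linarith

/-- The continued fraction of `1 - u` for small `u`. -/
lemma one_div_one_sub_gauss (h0 : 1 / 2 < v) (h1 : v < 1) :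
    1 / (1 - v) = 1 / gauss v + 1 := by
  rw [gauss_sub_one h0 h1]
  have : 1 - v ≠ 0 := by linarith
  have h3 : v ≠ 0 := by linarith
  have : 1 / v - 1 ≠ 0 := by
    rw [div_sub_one h3]; exact div_ne_zero this h3
  field_simp
  ring

lemma gauss_gauss_eq (hq : 0 < β ^ 2 - 3 * β + 1) (h0 : 0 < β) (h2 : β < 1 / 2)
    (hx : hole β ≤ 1 - v) (hx2 : 1 - v < 1 / 2) :
    gauss (gauss v) = 1 / (1 - v) - 2 := by
  rw [hole, div_le_iff₀ (by linarith)] at hx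
  have hv1 : v < 1 := by nlinarith
  have hg := gauss_sub_one (by linarith) hv1
  have h4 : 1 / 2 < gauss v := by
    rw [hg, lt_sub_iff_add_lt, lt_div_iff₀ (by linarith)]
    nlinarith
  have h5 : gauss v < 1 := Int.fract_lt_one _
  rw [gauss_sub_one h4 h5, one_div_one_sub_gauss (by linarith) hv1]
  ring

end Dynamics

section States

variable {β x y v : ℝ}

/-- The sum of the reciprocals is an integer, and `1 / x` equals `± 1 / v` modulo `1`. -/
def ReciprocalState (x y v : ℝ) : Prop :=
  (∃ k : ℤ, 1 / x + 1 / y = k) ∧ ∃ s k : ℤ, (s = 1 ∨ s = -1) ∧ 1 / x = s * (1 / v) + k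

lemma reciprocalState_center {x y : ℝ} (hx : Irrational x) (hy0 : y ≠ 0) (hxy : x + y = 1) :
    ReciprocalState (1 / x - 2) (1 / y - 2) (1 / x - 2) ∧
      ReciprocalState (1 / x - 2) (1 / y - 2) (1 / y - 2) := by
  have h1 : 1 / (1 / x - 2) + 1 / (1 / y - 2) = -1 := by
    obtain rfl : y = 1 - x := by linarith
    have h3 : x - 1 / 2 ≠ 0 := by
      intro h
      exact (hx.ne_rat (1 / 2)) (by push_cast; linarith)
    have h4 : 1 - 2 * x ≠ 0 := fun h => h3 (by linarith)
    have h5 : 1 / x - 2 = (1 - 2 * x) / x := by have := hx.ne_zero; field_simp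
    have h6 : 1 / (1 - x) - 2 = -(1 - 2 * x) / (1 - x) := by field_simp; ring
    rw [h5, h6]
    have := hx.ne_zero
    field_simp
    ring
  exact ⟨⟨⟨-1, by push_cast; exact h1⟩, 1, 0, .inl rfl, by simp⟩,
    ⟨-1, by push_cast; exact h1⟩, -1, -1, .inr rfl, by push_cast; linarith⟩

lemma ReciprocalState.of_neg (s k : ℤ) (hs : s = 1 ∨ s = -1) (h : 1 / x = s * (1 / v) + k) :
    ReciprocalState x (-x) v := ⟨⟨0, by simp⟩, s, k, hs, h⟩

lemma state_step (h0 : 0 < β) (hq : 0 < β ^ 2 - 3 * β + 1) (h2 : β < 1 / 2)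
    (hx : x ∈ Ioo (-β) (1 - β)) (hy : y ∈ Ioo (-β) (1 - β)) (hxi : Irrational x)
    (hv : v ∈ Ioo (0 : ℝ) 1) {s i j : ℤ} (hs : s = 1 ∨ s = -1) (hxv : x = s * v + i)
    (hxy : x + y = j) :
    ((T (1 - β) x = T (1 - β) (T (1 - β) y) ∨ T (1 - β) (T (1 - β) x) = T (1 - β) y) ∧
      (v ∈ Ioo β (hole β) ∨ 1 - v ∈ Ioo β (hole β))) ∨
    (v ∉ Ioo β (hole β) ∧ ∃ m ≤ 2, (v < β → m = 0) ∧
      (ReciprocalState x y (gauss^[m] v) ∨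
        ReciprocalState (T (1 - β) x) (T (1 - β) y) (gauss^[m] v))) := by
  obtain ⟨hx1, hx2⟩ := hx
  obtain ⟨hy1, hy2⟩ := hy
  obtain ⟨hv1, hv2⟩ := hv
  have hh := hole_lt_half h0 h2
  have hth := third_lt_hole h2
  have hj : j = 0 ∨ j = 1 := by
    have e1 : (-1 : ℝ) < j := by linarith
    have e2 : (j : ℝ) < 2 := by linarith
    norm_cast at e1 e2
    omega
  have hform : x = v ∨ x = v - 1 ∨ x = -v ∨ x = 1 - v := by
    rcases hs with rfl | rfl
    · have e1 : (-2 : ℝ) < i := by push_cast at hxv; linarith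
      have e2 : (i : ℝ) < 1 := by push_cast at hxv; linarith
      norm_cast at e1 e2
      obtain rfl | rfl : i = -1 ∨ i = 0 := by omega
      · right; left; push_cast at hxv; linarith
      · left; push_cast at hxv; linarith
    · have e1 : (-1 : ℝ) < i := by push_cast at hxv; linarith
      have e2 : (i : ℝ) < 2 := by push_cast at hxv; linarith
      norm_cast at e1 e2
      obtain rfl | rfl : i = 0 ∨ i = 1 := by omega
      · right; right; left; push_cast at hxv; linarith
      · right; right; right; push_cast at hxv; linarith
  rcases hj with rfl | rfl
  · right
    obtain rfl : y = -x := by push_cast at hxy; linarith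
    rcases hform with rfl | rfl | rfl | rfl
    · exact ⟨fun h => by linarith [h.1], 0, by norm_num, fun _ => rfl, .inl
        (.of_neg 1 0 (.inl rfl) (by simp))⟩
    · refine ⟨fun h => by linarith [h.2], 1, by norm_num, fun h => by linarith, .inl
        (.of_neg (-1) (-1) (.inr rfl) ?_)⟩
      have := one_div_one_sub_gauss (v := v) (by linarith) hv2
      rw [← neg_sub, one_div_neg_eq_neg_one_div, this]
      push_cast
      simp
      ring
    · exact ⟨fun h => by linarith [h.1], 0, by norm_num, fun _ => rfl, .inl
        (.of_neg (-1) 0 (.inr rfl) (by simp))⟩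
    · refine ⟨fun h => by linarith [h.2], 1, by norm_num, fun h => by linarith, .inl
        (.of_neg 1 1 (.inl rfl) ?_)⟩
      have := one_div_one_sub_gauss (v := v) (by linarith) hv2
      rw [this]
      simp
  · obtain rfl : y = 1 - x := by push_cast at hxy; linarith
    have hxne : x ≠ 1 / 2 := fun h => hxi.ne_rat (1 / 2) (by push_cast; exact h)
    have hy0 : 1 - x ≠ 0 := by linarith
    have hform' : x = v ∨ x = 1 - v := by
      rcases hform with h | h | h | h
      · exact .inl h
      · linarith
      · linarith
      · exact .inr h
    have hvβ : β < v := by rcases hform' with h | h <;> linarith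
    obtain ⟨c1, c2⟩ := reciprocalState_center (y := 1 - x) hxi hy0 (by ring)
    rcases lt_or_gt_of_ne hxne with hlo | hlo
    · rcases lt_or_ge x (hole β) with hm | hm
      · left
        refine ⟨.inl (T_T_one_sub_eq h0 hq h2 (by linarith) hm).symm, ?_⟩
        rcases hform' with rfl | rfl
        · exact .inl ⟨hvβ, hm⟩
        · exact .inr ⟨by linarith, hm⟩
      · right
        obtain ⟨t1, t2⟩ := T_center h0 hq h2 hm hlo
        rcases hform' with rfl | rfl
        · refine ⟨fun h => by linarith [h.2], 1, by norm_num, fun h => by linarith, .inr ?_⟩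
          rw [t1, t2, Function.iterate_one, gauss_sub_two (by linarith) hlo.le]
          exact c1
        · refine ⟨fun h => by linarith [h.2], 2, le_rfl, fun h => by linarith, .inr ?_⟩
          rw [t1, t2]
          change ReciprocalState _ _ (gauss (gauss v))
          rw [gauss_gauss_eq hq h0 h2 hm hlo]
          exact c1
    · have hlo' : 1 - x < 1 / 2 := by linarith
      rcases lt_or_ge (1 - x) (hole β) with hm | hm
      · left
        have := T_T_one_sub_eq h0 hq h2 (by linarith) hm
        rw [sub_sub_cancel] at this
        refine ⟨.inr this, ?_⟩
        rcases hform' with rfl | rfl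
        · exact .inr ⟨by linarith, hm⟩
        · exact .inl ⟨by linarith, by linarith⟩
      · right
        obtain ⟨t1, t2⟩ := T_center h0 hq h2 hm hlo'
        rw [sub_sub_cancel] at t2
        rcases hform' with rfl | rfl
        · refine ⟨fun h => by linarith [h.2], 2, le_rfl, fun h => by linarith, .inr ?_⟩
          rw [t1, t2]
          change ReciprocalState _ _ (gauss (gauss x))
          rw [gauss_gauss_eq hq h0 h2 hm hlo']
          exact c2
        · rw [sub_sub_cancel] at t1 hm c2
          refine ⟨fun h => by linarith [h.2], 1, by norm_num, fun h => by linarith, .inr ?_⟩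
          rw [t2, sub_sub_cancel, t1, Function.iterate_one,
            gauss_sub_two (by linarith) (by linarith)]
          exact c2

end States

section Orbits

variable {β : ℝ} {n m : ℕ}

/-- The orbit of `1 - β`, one step ahead of the orbit of `-β`, is given by the `m`-th point of the
Gauss orbit of `β`, up to sign and integers. -/
def OrbitState (β : ℝ) (n m : ℕ) : Prop :=
  1 ≤ n ∧ (∃ s i : ℤ, (s = 1 ∨ s = -1) ∧ (T (1 - β))^[n + 1] (1 - β) = s * gauss^[m] β + i) ∧
    ∃ j : ℤ, (T (1 - β))^[n + 1] (1 - β) + (T (1 - β))^[n] (1 - β - 1) = j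

lemma ReciprocalState.orbitState (hβ : NonQuadratic (1 - β)) (h0 : 0 < β) (h1 : β < 1)
    (h : ReciprocalState ((T (1 - β))^[n + 1] (1 - β)) ((T (1 - β))^[n] (1 - β - 1))
      (gauss^[m] β)) : OrbitState β (n + 1) (m + 1) := by
  have hx := (right_irrational hβ (by linarith) (by linarith) (n + 1)).ne_zero
  have hy := (left_irrational hβ (by linarith) (by linarith) n).ne_zero
  obtain ⟨⟨k, hk⟩, s, l, hs, hl⟩ := h
  simp only [OrbitState, Function.iterate_succ_apply' _ (n + 1),
    Function.iterate_succ_apply' _ n (1 - β - 1), Function.iterate_succ_apply' gauss]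
  obtain ⟨i, hi⟩ := T_eq_gauss (α := 1 - β) hx s l hl
  exact ⟨by omega, ⟨s, i, hs, hi⟩, T_add_T hx hy k hk⟩

lemma OrbitState.step (hβ : NonQuadratic (1 - β)) (h0 : 0 < β) (hq : 0 < β ^ 2 - 3 * β + 1)
    (h2 : β < 1 / 2) (h : OrbitState β n m) :
    (Merges (1 - β) ∧ (gauss^[m] β ∈ Ioo β (hole β) ∨ 1 - gauss^[m] β ∈ Ioo β (hole β))) ∨
    (gauss^[m] β ∉ Ioo β (hole β) ∧ ∃ n' m', n < n' ∧ m < m' ∧ m' ≤ m + 3 ∧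
      (gauss^[m] β < β → m' = m + 1) ∧ OrbitState β n' m') := by
  obtain ⟨hn, ⟨s, i, hs, hx⟩, j, hj⟩ := h
  have hα0 : 0 < 1 - β := by linarith
  have hα1 : 1 - β < 1 := by linarith
  have hirr : Irrational β := by simpa using hβ.one_sub.irrational
  have hmx := right_mem_Ioo hβ hα0 hα1 n
  have hmy := left_mem_Ioo hβ hα0 hα1 (n - 1)
  rw [Nat.sub_add_cancel hn] at hmy
  rw [show 1 - β - 1 = -β by ring] at hmx hmy hj
  have hm0 : gauss^[m] β ∈ Ioo (0 : ℝ) 1 := by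
    cases m with
    | zero => exact ⟨h0, by simpa using by linarith⟩
    | succ m =>
      rw [Function.iterate_succ_apply']
      exact gauss_mem_Ioo (gauss_iterate_irrational hirr m)
  rcases state_step h0 hq h2 hmx hmy (right_irrational hβ hα0 hα1 (n + 1)) hm0 hs hx hj with
    ⟨h3, h4⟩ | ⟨h3, k, hk, hk', h4⟩
  · left
    refine ⟨?_, h4⟩
    simp only [← Function.iterate_succ_apply'] at h3
    rw [← show 1 - β - 1 = -β by ring] at h3
    rcases h3 with h3 | h3
    · exact ⟨_, _, h3.symm⟩
    · exact ⟨_, _, h3.symm⟩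
  · right
    rw [← Function.iterate_add_apply] at h4
    simp only [← Function.iterate_succ_apply'] at h4
    rw [← show 1 - β - 1 = -β by ring] at h4
    refine ⟨h3, ?_⟩
    rcases h4 with h4 | h4
    · exact ⟨n + 1, k + m + 1, by omega, by omega, by omega, fun h => by have := hk' h; omega,
        h4.orbitState hβ h0 (by linarith)⟩
    · exact ⟨n + 1 + 1, k + m + 1, by omega, by omega, by omega,
        fun h => by have := hk' h; omega, h4.orbitState hβ h0 (by linarith)⟩

lemma orbitState_one (hβ : NonQuadratic (1 - β)) (h0 : 0 < β) (hq : 0 < β ^ 2 - 3 * β + 1)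
    (h2 : β < 1 / 2) : OrbitState β 1 1 := by
  have h1 : 1 - β ≠ 0 := by linarith
  have e1 : T (1 - β) (1 - β) = β / (1 - β) := by
    refine T_eq_of_mem h1 ⟨?_, ?_⟩ 1 (by push_cast; field_simp; ring)
    · have : 0 < β / (1 - β) := div_pos h0 (by linarith)
      linarith
    · rw [div_lt_iff₀ (by linarith)]
      nlinarith
  refine ReciprocalState.orbitState (n := 0) (m := 0) hβ h0 (by linarith) ?_
  simp only [zero_add, Function.iterate_one, Function.iterate_zero, id, e1]
  rw [show 1 - β - 1 = -β by ring]
  exact ⟨⟨-1, by push_cast; field_simp; ring⟩, 1, -1, .inl rfl, by push_cast; field_simp; ring⟩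

/-- Orbits meet if some point of the Gauss orbit of `β` lies in the hole, and the three previous
ones are small. -/
lemma merges_of_gauss (hβ : NonQuadratic (1 - β)) (h0 : 0 < β) (hq : 0 < β ^ 2 - 3 * β + 1)
    (h2 : β < 1 / 2) {k : ℕ} (hk : 1 ≤ k) (hsmall : ∀ i < 3, gauss^[k + i] β < β)
    (hhole : gauss^[k + 3] β ∈ Ioo β (hole β)) : Merges (1 - β) := by
  by_contra hM
  have step {n m : ℕ} (h : OrbitState β n m) := (h.step hβ h0 hq h2).resolve_left fun h => hM h.1
  have h3 : ∀ l ≥ 1, ∃ m n, l ≤ m ∧ m ≤ l + 2 ∧ OrbitState β n m := by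
    intro l hl
    induction l, hl using Nat.le_induction with
    | base => exact ⟨1, 1, le_rfl, by norm_num, orbitState_one hβ h0 hq h2⟩
    | succ l hl ih =>
      obtain ⟨m, n, hm1, hm2, hm⟩ := ih
      rcases hm1.lt_or_eq with h | rfl
      · exact ⟨m, n, by omega, by omega, hm⟩
      · obtain ⟨-, n', m', -, h4, h5, -, h6⟩ := step hm
        exact ⟨m', n', by omega, by omega, h6⟩
  obtain ⟨m, n, hm1, hm2, hm⟩ := h3 k hk
  have h4 : ∀ d ≤ 3, ∀ m n, m + d = k + 3 → OrbitState β n m → ∃ n', OrbitState β n' (k + 3) := by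
    intro d hd
    induction d with
    | zero => rintro m n rfl h; exact ⟨n, h⟩
    | succ d ih =>
      intro m n hmd h
      obtain ⟨-, n', m', -, -, -, h5, h6⟩ := step h
      have h7 := hsmall (2 - d) (by omega)
      rw [show k + (2 - d) = m by omega] at h7
      exact ih (by omega) m' n' (by rw [h5 h7]; omega) h6
  obtain ⟨n', hn'⟩ := h4 (k + 3 - m) (by omega) m n (by omega) hm
  exact (step hn').1 hhole

/-- If the Gauss orbit of `β` avoids the hole and its mirror image, then the orbits never meet. -/
lemma not_merges_of_gauss (hβ : NonQuadratic (1 - β)) (h0 : 0 < β)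
    (hq : 0 < β ^ 2 - 3 * β + 1) (h2 : β < 1 / 2)
    (hhole : ∀ m ≥ 1, gauss^[m] β ∉ Ioo β (hole β) ∧ 1 - gauss^[m] β ∉ Ioo β (hole β)) :
    ¬ Merges (1 - β) := by
  rintro ⟨M, N, hMN⟩
  have hα0 : 0 < 1 - β := by linarith
  have hα1 : 1 - β < 1 := by linarith
  obtain ⟨n, m, hn, -, hS⟩ : ∃ n m, M ≤ n ∧ 1 ≤ m ∧ OrbitState β n m := by
    clear hMN
    induction M with
    | zero => exact ⟨1, 1, by norm_num, le_rfl, orbitState_one hβ h0 hq h2⟩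
    | succ M ih =>
      obtain ⟨n, m, hn, hm, hS⟩ := ih
      rcases hS.step hβ h0 hq h2 with ⟨-, h | h⟩ | ⟨-, n', m', h3, h4, -, -, h5⟩
      · exact absurd h (hhole m hm).1
      · exact absurd h (hhole m hm).2
      · exact ⟨n', m', by omega, by omega, h5⟩
  have h3 : (T (1 - β))^[n] (1 - β - 1) = (T (1 - β))^[n - M + N] (1 - β) := by
    rw [Function.iterate_add_apply, ← hMN, ← Function.iterate_add_apply, Nat.sub_add_cancel hn]
  obtain ⟨-, -, j, hj⟩ := hS
  have hl := localMoebius_left hβ hα0 hα1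
  have hr := localMoebius_right hβ hα0 hα1
  have p1 := orbitProd_eq_of_int hβ (hl n) (hr (n - M + N)) 1 (by norm_num) 0 (by
    simp only [Int.cast_one, Int.cast_zero, sub_zero, one_mul, add_zero]; exact h3.symm)
  have p2 := orbitProd_eq_of_int hβ (hl n) (hr (n + 1)) (-1) (by norm_num) j (by
    simp only [Int.cast_one, Int.cast_zero, Int.cast_neg, sub_zero, one_mul, neg_mul]; linarith)
  have p3 := (orbitProd_strictAnti hβ hα0 hα1 (.inl rfl)).injective (p1.trans p2.symm)
  rw [p3] at h3
  rw [h3] at hj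
  exact (right_irrational hβ hα0 hα1 (n + 1)).ne_rat (j / 2) (by push_cast; linarith)

end Orbits

section Explicit

variable {β : ℝ}

lemma merges_of_sqrt_two_lt (h : 0 < β ^ 2 + 2 * β - 1) (hq : β ^ 2 - 3 * β + 1 < 0)
    (h0 : 0 < β) (h2 : β < 1 / 2) : Merges (1 - β) := by
  have h1 : 0 < 1 - β := by linarith
  have h3 : 2 * β - 1 ≠ 0 := by linarith
  have e1 : T (1 - β) (1 - β - 1) = (2 * β - 1) / β := by
    refine T_eq_of_mem (by linarith) ⟨?_, ?_⟩ (-2) ?_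
    · rw [le_div_iff₀ h0]; nlinarith
    · rw [div_lt_iff₀ h0]; nlinarith
    · rw [show 1 - β - 1 = -β by ring]; push_cast; field_simp; ring
  have e2 : T (1 - β) (1 - β) = (2 * β - 1) / (1 - β) := by
    refine T_eq_of_mem h1.ne' ⟨?_, ?_⟩ 2 ?_
    · rw [le_div_iff₀ h1]; nlinarith
    · rw [div_lt_iff₀ h1]; nlinarith
    · push_cast; field_simp; ring
  refine ⟨2, 2, ?_⟩
  simp only [Function.iterate_succ_apply', Function.iterate_zero, id, e1, e2]
  exact T_congr (div_ne_zero h3 h0.ne') (div_ne_zero h3 h1.ne') 1 (by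
    push_cast; field_simp; ring)

lemma merges_of_lt_sqrt_two (h : β ^ 2 + 2 * β - 1 < 0) (hq : β ^ 2 - 3 * β + 1 < 0)
    (h0 : 0 < β) (hne : 2 - 5 * β ≠ 0) : Merges (1 - β) := by
  have h2 : β < 0.415 := by nlinarith
  have h3 : 0.381 < β := by nlinarith
  have h1 : 0 < 1 - β := by linarith
  have h4 : 0 < 1 - 2 * β := by linarith
  have h4' : 2 * β - 1 ≠ 0 := by linarith
  have h5 : 0 < 3 * β - 1 := by linarith
  have e1 : T (1 - β) (1 - β - 1) = (3 * β - 1) / β := by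
    refine T_eq_of_mem (by linarith) ⟨?_, ?_⟩ (-3) ?_
    · rw [le_div_iff₀ h0]; nlinarith
    · rw [div_lt_iff₀ h0]; nlinarith
    · rw [show 1 - β - 1 = -β by ring]; push_cast; field_simp; ring
  have e2 : T (1 - β) (1 - β) = (2 * β - 1) / (1 - β) := by
    refine T_eq_of_mem h1.ne' ⟨?_, ?_⟩ 2 ?_
    · rw [le_div_iff₀ h1]; nlinarith
    · rw [div_lt_iff₀ h1]; nlinarith
    · push_cast; field_simp; ring
  have e3 : T (1 - β) ((3 * β - 1) / β) = (2 - 5 * β) / (3 * β - 1) := by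
    refine T_eq_of_mem (div_ne_zero h5.ne' h0.ne') ⟨?_, ?_⟩ 2 ?_
    · rw [le_div_iff₀ h5]; nlinarith
    · rw [div_lt_iff₀ h5]; nlinarith
    · push_cast; field_simp; ring
  have e4 : T (1 - β) ((2 * β - 1) / (1 - β)) = (2 - 5 * β) / (1 - 2 * β) := by
    refine T_eq_of_mem (div_ne_zero h4' h1.ne') ⟨?_, ?_⟩ (-3) ?_
    · rw [le_div_iff₀ h4]; nlinarith
    · rw [div_lt_iff₀ h4]; nlinarith
    · push_cast
      rw [show 2 * β - 1 = -(1 - 2 * β) by ring]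
      field_simp
      ring
  refine ⟨3, 3, ?_⟩
  simp only [Function.iterate_succ_apply', Function.iterate_zero, id, e1, e2, e3, e4]
  exact T_congr (div_ne_zero hne h5.ne') (div_ne_zero hne h4.ne') (-1) (by
    push_cast; field_simp; ring)

lemma merges_of_golden_lt (hβ : NonQuadratic (1 - β)) (h0 : 0 < β) (h2 : β < 1 / 2)
    (hq : β ^ 2 - 3 * β + 1 < 0) : Merges (1 - β) := by
  have hβ' : NonQuadratic β := by simpa using hβ.one_sub
  rcases lt_trichotomy (β ^ 2 + 2 * β - 1) 0 with h | h | h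
  · refine merges_of_lt_sqrt_two h hq h0 fun h5 => ?_
    have := hβ'.linear (a := -5) (b := 2) (by push_cast; linarith)
    simp at this
  · have := hβ' 1 2 (-1) (by push_cast; linarith)
    simp at this
  · exact merges_of_sqrt_two_lt h hq h0 h2

end Explicit

section Words

/-- The inverse branch of an iterate of the Gauss map with prescribed digits. -/
noncomputable def branch : List ℕ → ℝ → ℝ
  | [], t => t
  | a :: w, t => 1 / (a + branch w t)

/-- The length of the cylinder set of a finite list of digits. -/
noncomputable def cylLength (w : List ℕ) : ℝ := |branch w 1 - branch w 0|

variable {w : List ℕ} {s t : ℝ}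

lemma branch_append (v w : List ℕ) (t : ℝ) : branch (v ++ w) t = branch v (branch w t) := by
  induction v with
  | nil => rfl
  | cons a v ih => simp [branch, ih]

lemma branch_moebius (hw : ∀ a ∈ w, 1 ≤ a) : ∃ P P' Q Q' : ℝ, 0 ≤ P ∧ 0 ≤ P' ∧ 0 ≤ Q' ∧ 1 ≤ Q ∧
    Q' ≤ Q ∧ Q' + P' ≤ Q + P ∧ |P * Q' - P' * Q| = 1 ∧ w.length ≤ Q ∧ (w ≠ [] → 1 ≤ P) ∧
    ∀ t ∈ Icc (0 : ℝ) 1, branch w t = (P + t * P') / (Q + t * Q') := by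
  induction w with
  | nil => exact ⟨0, 1, 1, 0, by simp [branch]⟩
  | cons a w ih =>
    obtain ⟨P, P', Q, Q', h1, h2, h3, h4, h5, h6, h7, h8, h9, h10⟩ :=
      ih fun b hb => hw b (List.mem_cons_of_mem _ hb)
    have ha : (1 : ℝ) ≤ a := by exact_mod_cast hw a List.mem_cons_self
    refine ⟨Q, Q', a * Q + P, a * Q' + P', by linarith, h3, by positivity, by nlinarith, by nlinarith,
      by nlinarith, ?_, ?_, fun _ => h4, fun t ht => ?_⟩
    · rw [← h7, abs_sub_comm]; congr 1; ring
    · by_cases hn : w = []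
      · subst hn; simp; nlinarith
      · have := h9 hn
        push_cast [List.length_cons]
        nlinarith
    · have : 0 < Q + t * Q' := by nlinarith [mul_nonneg ht.1 h3]
      rw [branch, h10 t ht]
      have h11 : 0 < a * (Q + t * Q') + (P + t * P') := by
        have := mul_nonneg ht.1 h2
        positivity
      have h12 : (a : ℝ) * Q + P + t * (a * Q' + P') ≠ 0 := by
        convert h11.ne' using 1; ring
      field_simp
      ring

lemma branch_bounds (hw : ∀ a ∈ w, 1 ≤ a) : 0 < cylLength w ∧ cylLength w * w.length ^ 2 ≤ 1 ∧
    ∀ s ∈ Icc (0 : ℝ) 1, ∀ t ∈ Icc (0 : ℝ) 1,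
      cylLength w / 2 * |s - t| ≤ |branch w s - branch w t| ∧
      |branch w s - branch w t| ≤ 2 * cylLength w * |s - t| := by
  obtain ⟨P, P', Q, Q', h1, h2, h3, h4, h5, h6, h7, h8, h9, h10⟩ := branch_moebius hw
  have key : ∀ s ∈ Icc (0 : ℝ) 1, ∀ t ∈ Icc (0 : ℝ) 1,
      |branch w s - branch w t| = |s - t| / ((Q + s * Q') * (Q + t * Q')) := by
    intro s hs t ht
    have e1 : 0 < Q + s * Q' := by nlinarith [mul_nonneg hs.1 h3]
    have e2 : 0 < Q + t * Q' := by nlinarith [mul_nonneg ht.1 h3]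
    rw [h10 s hs, h10 t ht, div_sub_div _ _ e1.ne' e2.ne', abs_div, abs_of_pos (mul_pos e1 e2)]
    congr 1
    rw [show (P + s * P') * (Q + t * Q') - (Q + s * Q') * (P + t * P')
      = (P * Q' - P' * Q) * (t - s) by ring, abs_mul, h7, one_mul, abs_sub_comm]
  have hl : cylLength w = 1 / ((Q + Q') * Q) := by
    rw [cylLength, key 1 (by simp) 0 (by simp)]; simp
  have hQ : 0 < Q := by linarith
  refine ⟨by rw [hl]; positivity, ?_, fun s hs t ht => ?_⟩
  · rw [hl, one_div_mul_eq_div, div_le_one (by positivity)]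
    have : (0 : ℝ) ≤ w.length := by positivity
    nlinarith
  · have e1 : Q ≤ Q + s * Q' := by nlinarith [mul_nonneg hs.1 h3]
    have e2 : Q ≤ Q + t * Q' := by nlinarith [mul_nonneg ht.1 h3]
    have e3 : Q + s * Q' ≤ Q + Q' := by nlinarith [mul_le_mul_of_nonneg_right hs.2 h3]
    have e4 : Q + t * Q' ≤ Q + Q' := by nlinarith [mul_le_mul_of_nonneg_right ht.2 h3]
    have e5 : Q * Q ≤ (Q + s * Q') * (Q + t * Q') := mul_le_mul e1 e2 hQ.le (by linarith)
    have e6 : (Q + s * Q') * (Q + t * Q') ≤ (Q + Q') * (Q + Q') :=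
      mul_le_mul e3 e4 (by linarith) (by linarith)
    have e7 : 0 < (Q + s * Q') * (Q + t * Q') := by nlinarith
    rw [key s hs t ht, hl]
    constructor
    · rw [div_eq_mul_inv |s - t|, mul_comm]
      gcongr
      rw [div_div, one_div]
      exact inv_anti₀ e7 (by nlinarith)
    · rw [div_eq_mul_inv |s - t|, mul_comm]
      gcongr
      rw [mul_one_div, inv_le_comm₀ e7 (by positivity), inv_div]
      refine le_trans ?_ e5
      nlinarith

lemma branch_mem_Ioo (hw : ∀ a ∈ w, 1 ≤ a) (ht : t ∈ Ioo (0 : ℝ) 1) :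
    branch w t ∈ Ioo (0 : ℝ) 1 := by
  induction w with
  | nil => exact ht
  | cons a w ih =>
    have h := ih fun b hb => hw b (List.mem_cons_of_mem _ hb)
    have ha : (1 : ℝ) ≤ a := by exact_mod_cast hw a List.mem_cons_self
    have : 0 < (a : ℝ) + branch w t := by linarith [h.1]
    rw [branch]
    exact ⟨by positivity, by rw [div_lt_one this]; linarith [h.1]⟩

lemma gauss_one_div_add (a : ℕ) (ht : t ∈ Ico (0 : ℝ) 1) : gauss (1 / (a + t)) = t :=
  gauss_eq_of_mem ht a (by rw [one_div_one_div]; push_cast; ring)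

lemma gauss_iterate_branch (hw : ∀ a ∈ w, 1 ≤ a) (ht : t ∈ Ioo (0 : ℝ) 1) :
    gauss^[w.length] (branch w t) = t := by
  induction w with
  | nil => rfl
  | cons a w ih =>
    have h : ∀ b ∈ w, 1 ≤ b := fun b hb => hw b (List.mem_cons_of_mem _ hb)
    rw [List.length_cons, Function.iterate_succ_apply, branch,
      gauss_one_div_add a (Ioo_subset_Ico_self (branch_mem_Ioo h ht)), ih h]

/-- Every irrational number is in the image of a branch of any given length. -/
lemma exists_branch_eq {x : ℝ} (hx : Irrational x) (h01 : x ∈ Ioo (0 : ℝ) 1) (n : ℕ) :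
    ∃ w : List ℕ, w.length = n ∧ (∀ a ∈ w, 1 ≤ a) ∧ branch w (gauss^[n] x) = x := by
  induction n generalizing x with
  | zero => exact ⟨[], by simp [branch]⟩
  | succ n ih =>
    obtain ⟨w, h1, h2, h3⟩ := ih (gauss_irrational hx) (gauss_mem_Ioo hx)
    obtain ⟨k, hk⟩ := gauss_spec x
    have hg := gauss_mem_Ioo hx
    have hk1 : 1 ≤ k := by
      have : 1 < 1 / x := by rw [lt_div_iff₀ h01.1]; linarith [h01.2]
      have : (0 : ℝ) < k := by linarith [hg.2]
      exact_mod_cast this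
    refine ⟨k.toNat :: w, by simp [h1], ?_, ?_⟩
    · simp only [List.mem_cons, forall_eq_or_imp]
      exact ⟨by omega, h2⟩
    · rw [Function.iterate_succ_apply, branch, h3]
      have : ((k.toNat : ℕ) : ℝ) = k := by exact_mod_cast Int.toNat_of_nonneg (by omega)
      rw [this, add_comm, ← hk, one_div_one_div]

lemma continuousOn_branch (hw : ∀ a ∈ w, 1 ≤ a) : ContinuousOn (branch w) (Icc 0 1) := by
  have hb := (branch_bounds hw)
  refine (LipschitzOnWith.of_dist_le_mul (K := ⟨2 * cylLength w, by linarith [hb.1]⟩)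
    fun s hs t ht => ?_).continuousOn
  exact (hb.2.2 s hs t ht).2

end Words

section Density

open scoped Topology

variable {p q : ℝ}

/-- Points whose orbits miss an interval are sparse in cylinders. -/
lemma measure_avoiding_le (hp : 0 < p) (hpq : p < q) (hq : q < 1) {B : Set ℝ}
    (hB : ∀ x ∈ B, x ∈ Ioo (0 : ℝ) 1 ∧ Irrational x ∧ ∀ k, 1 ≤ k → gauss^[k] x ∉ Ioo p q)
    {x : ℝ} (hx : x ∈ B) (n : ℕ) : ∃ r : ℝ, 0 < r ∧ r ≤ 2 / ((n : ℝ) + 1) ^ 2 ∧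
      volume (B ∩ Metric.closedBall x r) / volume (Metric.closedBall x r) ≤
        ENNReal.ofReal (1 - (q - p) / 8) := by
  obtain ⟨h01, hirr, -⟩ := hB x hx
  obtain ⟨w, hlen, hpos, hw⟩ := exists_branch_eq hirr h01 (n + 1)
  obtain ⟨hl0, hl1, hb⟩ := branch_bounds hpos
  set l := cylLength w
  have hp' : p ∈ Icc (0 : ℝ) 1 := ⟨hp.le, by linarith⟩
  have hq' : q ∈ Icc (0 : ℝ) 1 := ⟨by linarith, hq.le⟩
  have hsub : uIcc p q ⊆ Icc 0 1 := uIcc_subset_Icc hp' hq'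
  have ht := Ioo_subset_Icc_self (gauss_mem_Ioo (gauss_iterate_irrational hirr n))
  rw [← Function.iterate_succ_apply' gauss] at ht
  set J := Ioo (min (branch w p) (branch w q)) (max (branch w p) (branch w q))
  have hJ : ∀ y ∈ J, ∃ s ∈ Ioo p q, branch w s = y := by
    intro y hy
    obtain ⟨s, hs, rfl⟩ := intermediate_value_uIcc ((continuousOn_branch hpos).mono hsub)
      (Ioo_subset_Icc_self hy)
    rw [uIcc_of_le hpq.le] at hs
    refine ⟨s, ⟨lt_of_le_of_ne hs.1 ?_, lt_of_le_of_ne hs.2 ?_⟩, rfl⟩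
    · rintro rfl
      rcases le_total (branch w p) (branch w q) with h | h <;> simp [J, h] at hy
    · rintro rfl
      rcases le_total (branch w p) (branch w s) with h | h <;> simp [J, h] at hy
  have hJB : J ⊆ Metric.closedBall x (2 * l) := by
    intro y hy
    obtain ⟨s, hs, rfl⟩ := hJ y hy
    have hs' : s ∈ Icc (0 : ℝ) 1 := ⟨by linarith [hs.1], by linarith [hs.2]⟩
    rw [Metric.mem_closedBall, Real.dist_eq, ← hw]
    refine (hb s hs' _ ht).2.trans ?_
    have : |s - gauss^[n + 1] x| ≤ 1 := by
      rw [abs_le]; constructor <;> linarith [hs'.1, hs'.2, ht.1, ht.2]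
    nlinarith
  have hBJ : B ∩ Metric.closedBall x (2 * l) ⊆ Metric.closedBall x (2 * l) \ J := by
    rintro y ⟨hy, hy'⟩
    refine ⟨hy', fun hyJ => ?_⟩
    obtain ⟨s, hs, rfl⟩ := hJ y hyJ
    have := (hB _ hy).2.2 (n + 1) (by omega)
    rw [← hlen, gauss_iterate_branch hpos ⟨by linarith [hs.1], by linarith [hs.2]⟩] at this
    exact this hs
  have hvJ : volume J = ENNReal.ofReal |branch w p - branch w q| := by
    rw [Real.volume_Ioo, max_sub_min_eq_abs, abs_sub_comm]
  have hlow := (hb p hp' q hq').1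
  rw [abs_sub_comm p q, abs_of_pos (sub_pos.2 hpq)] at hlow
  refine ⟨2 * l, by positivity, ?_, ?_⟩
  · rw [hlen] at hl1
    push_cast at hl1
    rw [le_div_iff₀ (by positivity)]
    linarith
  · rw [Real.volume_closedBall]
    refine ENNReal.div_le_of_le_mul ((measure_mono hBJ).trans ?_)
    rw [measure_sdiff hJB measurableSet_Ioo.nullMeasurableSet (by rw [hvJ]; simp),
      Real.volume_closedBall, hvJ, ← ENNReal.ofReal_sub _ (abs_nonneg _),
      ← ENNReal.ofReal_mul (by linarith)]
    refine ENNReal.ofReal_le_ofReal ?_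
    nlinarith

lemma measure_avoiding (hp : 0 < p) (hpq : p < q) (hq : q < 1) {B : Set ℝ}
    (hB : ∀ x ∈ B, x ∈ Ioo (0 : ℝ) 1 ∧ Irrational x ∧ ∀ k, 1 ≤ k → gauss^[k] x ∉ Ioo p q) :
    volume B = 0 := by
  have h := Besicovitch.ae_tendsto_measure_inter_div (volume : Measure ℝ) B
  rw [ae_iff] at h
  rw [← Measure.restrict_apply_self volume B]
  refine measure_mono_null ?_ h
  intro x hx hlim
  choose r h0 h1 h2 using measure_avoiding_le hp hpq hq hB hx
  have hr : Tendsto r atTop (𝓝[>] 0) := by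
    have hlim := (tendsto_one_div_add_atTop_nhds_zero_nat (𝕜 := ℝ)).const_mul 2
    rw [mul_zero] at hlim
    refine tendsto_nhdsWithin_iff.2 ⟨squeeze_zero (fun n => (h0 n).le) (fun n => (h1 n).trans ?_)
      hlim, .of_forall h0⟩
    rw [mul_one_div]
    have : (0 : ℝ) ≤ n := by positivity
    gcongr
    nlinarith
  have := le_of_tendsto' (hlim.comp hr) h2
  rw [ENNReal.one_le_ofReal] at this
  linarith

/-- Almost every orbit of the Gauss map visits a given interval. -/
lemma ae_exists_gauss_mem (hp : 0 < p) (hpq : p < q) (hq : q < 1) :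
    ∀ᵐ x : ℝ, x ∈ Ioo (0 : ℝ) 1 → Irrational x → ∃ k, 1 ≤ k ∧ gauss^[k] x ∈ Ioo p q := by
  rw [ae_iff]
  refine measure_avoiding hp hpq hq fun x hx => ?_
  simpa [and_assoc] using hx

lemma exists_Ioo_gauss (hp : 0 < p) (hpq : p < q) (hq : q < 1) {ε : ℝ} (hε : 0 < ε) :
    ∃ p' q' : ℝ, 0 < p' ∧ p' < q' ∧ q' < 1 ∧ ∀ y ∈ Ioo p' q', y < ε ∧ gauss y ∈ Ioo p q := by
  obtain ⟨K, hK⟩ := exists_nat_gt (max 1 (1 / ε))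
  obtain ⟨hK1, hK2⟩ := max_lt_iff.1 hK
  have hp' : 0 < K + p := by linarith
  have hq' : 0 < K + q := by linarith
  have hKε : 1 / (K + p) < ε := by
    rw [div_lt_iff₀ hp']
    rw [div_lt_iff₀ hε] at hK2
    nlinarith
  refine ⟨1 / (K + q), 1 / (K + p), by positivity, by gcongr, ?_, fun y hy => ?_⟩
  · rw [div_lt_one hp']; linarith
  · have hy0 : 0 < y := lt_trans (by positivity) hy.1
    have h1 : 1 / y < K + q := by rw [one_div_lt hy0 hq']; exact hy.1
    have h2 : K + p < 1 / y := by rw [lt_one_div hp' hy0]; exact hy.2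
    have : gauss y = 1 / y - K :=
      gauss_eq_of_mem ⟨by linarith, by linarith⟩ K (by push_cast; ring)
    rw [this]
    exact ⟨hy.2.trans hKε, by linarith, by linarith⟩

/-- Orbits of the Gauss map visit an interval after three small values. -/
lemma ae_exists_gauss_mem_of_small (hp : 0 < p) (hpq : p < q) (hq : q < 1) {ε : ℝ} (hε : 0 < ε) :
    ∀ᵐ x : ℝ, x ∈ Ioo (0 : ℝ) 1 → Irrational x →
      ∃ k, 1 ≤ k ∧ (∀ i < 3, gauss^[k + i] x < ε) ∧ gauss^[k + 3] x ∈ Ioo p q := by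
  obtain ⟨p₁, q₁, h1, h2, h3, h4⟩ := exists_Ioo_gauss hp hpq hq hε
  obtain ⟨p₂, q₂, h5, h6, h7, h8⟩ := exists_Ioo_gauss h1 h2 h3 hε
  obtain ⟨p₃, q₃, h9, h10, h11, h12⟩ := exists_Ioo_gauss h5 h6 h7 hε
  filter_upwards [ae_exists_gauss_mem h9 h10 h11] with x hx h01 hirr
  obtain ⟨k, hk, hk0⟩ := hx h01 hirr
  obtain ⟨e0, hk1⟩ := h12 _ hk0
  rw [← Function.iterate_succ_apply' gauss] at hk1
  obtain ⟨e1, hk2⟩ := h8 _ hk1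
  rw [← Function.iterate_succ_apply' gauss] at hk2
  obtain ⟨e2, hk3⟩ := h4 _ hk2
  rw [← Function.iterate_succ_apply' gauss] at hk3
  refine ⟨k, hk, fun i hi => ?_, hk3⟩
  interval_cases i
  exacts [e0, e1, e2]

end Density

section MeasureZero

lemma lt_hole {β : ℝ} (hq : 0 < β ^ 2 - 3 * β + 1) (h2 : β < 1 / 2) : β < hole β := by
  rw [hole, lt_div_iff₀ (by linarith)]
  nlinarith

lemma ae_merges_one_sub :
    ∀ᵐ β : ℝ, 0 < β → β < 1 / 2 → NonQuadratic (1 - β) → Merges (1 - β) := by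
  have h : ∀ᵐ β : ℝ, ∀ c d e : ℚ, (0 < c ∧ c < d ∧ d < 1 ∧ 0 < e) → β ∈ Ioo (0 : ℝ) 1 →
      Irrational β → ∃ k, 1 ≤ k ∧ (∀ i < 3, gauss^[k + i] β < e) ∧
        gauss^[k + 3] β ∈ Ioo (c : ℝ) d := by
    simp only [ae_all_iff]
    rintro c d e ⟨h1, h2, h3, h4⟩
    exact ae_exists_gauss_mem_of_small (by exact_mod_cast h1) (by exact_mod_cast h2)
      (by exact_mod_cast h3) (by exact_mod_cast h4)
  filter_upwards [h] with β h h0 h2 hβ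
  have hβ' : NonQuadratic β := by simpa using hβ.one_sub
  rcases lt_trichotomy (β ^ 2 - 3 * β + 1) 0 with hq | hq | hq
  · exact merges_of_golden_lt hβ h0 h2 hq
  · have := (hβ' 1 (-3) 1 (by push_cast; linarith)).1
    omega
  · obtain ⟨c, hc1, hc2⟩ := exists_rat_btwn (lt_hole hq h2)
    obtain ⟨d, hd1, hd2⟩ := exists_rat_btwn hc2
    obtain ⟨e, he1, he2⟩ := exists_rat_btwn h0
    have hh := hole_lt_half h0 h2
    obtain ⟨k, hk, hs, hm⟩ := h c d e ⟨by exact_mod_cast h0.trans hc1, by exact_mod_cast hd1,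
      by exact_mod_cast (show (d : ℝ) < 1 by linarith), by exact_mod_cast he1⟩
      ⟨h0, by linarith⟩ hβ'.irrational
    exact merges_of_gauss hβ h0 hq h2 hk (fun i hi => (hs i hi).trans he2)
      ⟨hc1.trans hm.1, hm.2.trans hd2⟩

lemma volume_E : volume E = 0 := by
  have h := ae_merges_one_sub
  have h' := (Measure.measurePreserving_sub_left (volume : Measure ℝ) 1).quasiMeasurePreserving.ae h
  have hn : ∀ᵐ α : ℝ, NonQuadratic α := by
    rw [ae_iff]
    exact countable_not_nonQuadratic.measure_zero _
  have : ∀ᵐ α : ℝ, α ∉ E := by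
    filter_upwards [h, h', hn] with α h1 h2 hα hE
    have h0 : 0 < α := lt_of_le_of_ne hE.1.1 hα.irrational.ne_zero.symm
    have h01 : α < 1 := lt_of_le_of_ne hE.1.2 hα.irrational.ne_one
    refine hE.2 (Merges.mem_matchingSet hα h0 h01 ?_)
    rcases lt_trichotomy α (1 / 2) with hlt | heq | hgt
    · simpa using (h1 h0 hlt hα.one_sub).one_sub hα.one_sub (by linarith) (by linarith)
    · have := (hα 0 2 (-1) (by push_cast; rw [heq]; norm_num)).2.1
      omega
    · simpa using h2 (by linarith) (by linarith) (by simpa using hα)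
  simpa [ae_iff] using this

end MeasureZero

section Coding

open scoped NNReal

variable {W : Type*}

lemma exists_cover (A : Finset W) {p : W → ℝ} :
    ∃ c : W → ℝ, ∀ t, 0 ≤ t → t < ∑ w ∈ A, p w → ∃ w ∈ A, c w ≤ t ∧ t < c w + p w := by
  classical
  induction A using Finset.induction_on with
  | empty => exact ⟨0, fun t h0 h1 => absurd h1 (by simpa using h0)⟩
  | insert a A ha ih =>
    obtain ⟨c, hc⟩ := ih
    refine ⟨Function.update c a (∑ w ∈ A, p w), fun t h0 h1 => ?_⟩
    rw [Finset.sum_insert ha] at h1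
    by_cases h : t < ∑ w ∈ A, p w
    · obtain ⟨w, hw, h2⟩ := hc t h0 h
      refine ⟨w, Finset.mem_insert_of_mem hw, ?_⟩
      rwa [Function.update_of_ne (by rintro rfl; exact ha hw)]
    · refine ⟨a, Finset.mem_insert_self _ _, ?_⟩
      rw [Function.update_self]
      constructor <;> linarith

/-- A lower bound for the dimension of a set that is coded by sequences. -/
lemma le_dimH_range [Fintype W] {ρ : W → ℝ} (h0 : ∀ w, 0 < ρ w) (h1 : ∀ w, ρ w < 1) {s : ℝ≥0}
    (hs : 0 < s) (hsum : 1 ≤ ∑ w, ρ w ^ (s : ℝ)) {x : (ℕ → W) → ℝ} {c : ℝ} (hc : 0 < c)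
    (hx : ∀ ω ω' k, (∀ i < k, ω i = ω' i) → ω k ≠ ω' k →
      c * ∏ i ∈ Finset.range k, ρ (ω i) ≤ |x ω - x ω'|) :
    (s : ℝ≥0∞) ≤ dimH (range x) := by
  classical
  have hs' : (0 : ℝ) < s := hs
  set p : W → ℝ := fun w => ρ w ^ (s : ℝ)
  have hp0 (w : W) : 0 < p w := Real.rpow_pos_of_pos (h0 w) _
  have hp1 (w : W) : p w < 1 := Real.rpow_lt_one (h0 w).le (h1 w) hs'
  obtain ⟨a, ha⟩ := exists_cover Finset.univ (p := p)
  have hne : Nonempty W := by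
    by_contra hempty
    rw [not_nonempty_iff] at hempty
    simp at hsum
    linarith
  have ha' : ∀ t : ℝ, ∃ w, t ∈ Ico (0 : ℝ) 1 → a w ≤ t ∧ t < a w + p w := by
    intro t
    by_cases ht : t ∈ Ico (0 : ℝ) 1
    · obtain ⟨w, -, hw⟩ := ha t ht.1 (ht.2.trans_le hsum)
      exact ⟨w, fun _ => hw⟩
    · exact ⟨hne.some, fun h => absurd h ht⟩
  choose d hd using ha'
  set S : ℝ → ℝ := fun t => (t - a (d t)) / p (d t)
  have hSp (t : ℝ) : p (d t) * S t + a (d t) = t := by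
    simp only [S]
    rw [mul_div_cancel₀ _ (hp0 _).ne', sub_add_cancel]
  have hS : ∀ k, ∀ t ∈ Ico (0 : ℝ) 1, S^[k] t ∈ Ico (0 : ℝ) 1 := by
    intro k
    induction k with
    | zero => exact fun t ht => ht
    | succ k ih =>
      intro t ht
      rw [Function.iterate_succ_apply']
      obtain ⟨e1, e2⟩ := hd _ (ih t ht)
      exact ⟨div_nonneg (by linarith) (hp0 _).le, by rw [div_lt_one (hp0 _)]; linarith⟩
  have hdiff : ∀ k t t', (∀ i < k, d (S^[i] t) = d (S^[i] t')) →
      t - t' = (∏ i ∈ Finset.range k, p (d (S^[i] t))) * (S^[k] t - S^[k] t') := by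
    intro k t t'
    induction k with
    | zero => simp
    | succ k ih =>
      intro h
      rw [ih fun i hi => h i (by omega), Finset.prod_range_succ, Function.iterate_succ_apply',
        Function.iterate_succ_apply', mul_assoc]
      congr 1
      have e1 := hSp (S^[k] t)
      have e2 := hSp (S^[k] t')
      rw [← h k (by omega)] at e2
      linear_combination e2 - e1
  have hprod : ∀ k t, t ∈ Ico (0 : ℝ) 1 → ∀ t' ∈ Ico (0 : ℝ) 1,
      (∀ i < k, d (S^[i] t) = d (S^[i] t')) →
      |t - t'| ≤ ∏ i ∈ Finset.range k, p (d (S^[i] t)) := by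
    intro k t ht t' ht' h
    have h3 : 0 ≤ ∏ i ∈ Finset.range k, p (d (S^[i] t)) :=
      Finset.prod_nonneg fun i _ => (hp0 _).le
    rw [hdiff k t t' h, abs_mul, abs_of_nonneg h3]
    refine mul_le_of_le_one_right h3 ?_
    have e1 := hS k t ht
    have e2 := hS k t' ht'
    rw [abs_le]
    constructor <;> linarith [e1.1, e1.2, e2.1, e2.2]
  set F : ℝ → ℝ := fun t => x fun k => d (S^[k] t)
  have hF : ∀ t ∈ Ico (0 : ℝ) 1, ∀ t' ∈ Ico (0 : ℝ) 1,
      |t - t'| ≤ c⁻¹ ^ (s : ℝ) * |F t - F t'| ^ (s : ℝ) := by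
    intro t ht t' ht'
    by_cases hall : ∀ k, d (S^[k] t) = d (S^[k] t')
    · obtain ⟨w, hw⟩ := Finite.exists_max p
      have : |t - t'| ≤ 0 := by
        refine ge_of_tendsto' (tendsto_pow_atTop_nhds_zero_of_lt_one (hp0 w).le (hp1 w))
          fun k => (hprod k t ht t' ht' fun i _ => hall i).trans ?_
        refine (Finset.prod_le_prod (fun i _ => (hp0 _).le) fun i _ => hw _).trans ?_
        simp
      exact this.trans (by positivity)
    · push Not at hall
      have hk := Nat.find_spec hall
      set k := Nat.find hall
      have hlt : ∀ i < k, d (S^[i] t) = d (S^[i] t') := fun i hi => by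
        simpa using Nat.find_min hall hi
      refine (hprod k t ht t' ht' hlt).trans ?_
      have h4 := hx _ _ k hlt hk
      rw [← Real.mul_rpow (by positivity) (abs_nonneg _),
        Real.finsetProd_rpow _ _ fun i _ => (h0 _).le]
      refine Real.rpow_le_rpow (Finset.prod_nonneg fun i _ => (h0 _).le) ?_ hs'.le
      rw [inv_mul_eq_div, le_div_iff₀ hc, mul_comm]
      exact h4
  set g := Function.invFunOn F (Ico 0 1)
  have hg : ∀ y ∈ F '' Ico 0 1, g y ∈ Ico (0 : ℝ) 1 ∧ F (g y) = y := fun y hy =>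
    ⟨Function.invFunOn_mem hy, Function.invFunOn_eq hy⟩
  have hH : HolderOnWith (Real.toNNReal (c⁻¹ ^ (s : ℝ))) s g (F '' Ico 0 1) := by
    intro y hy z hz
    obtain ⟨e1, e2⟩ := hg y hy
    obtain ⟨e3, e4⟩ := hg z hz
    have := hF _ e1 _ e3
    rw [e2, e4] at this
    rw [edist_dist, edist_dist, ENNReal.ofReal_rpow_of_nonneg dist_nonneg hs'.le]
    change _ ≤ ENNReal.ofReal _ * _
    rw [← ENNReal.ofReal_mul (by positivity)]
    exact ENNReal.ofReal_le_ofReal this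
  have himg : Ico (0 : ℝ) 1 ⊆ g '' (F '' Ico 0 1) := by
    intro t ht
    refine ⟨F t, mem_image_of_mem _ ht, ?_⟩
    obtain ⟨e1, e2⟩ := hg _ (mem_image_of_mem F ht)
    have := hF _ e1 _ ht
    rw [e2, sub_self, abs_zero, Real.zero_rpow hs'.ne', mul_zero] at this
    exact sub_eq_zero.1 (abs_nonpos_iff.1 this)
  have hone : dimH (Ico (0 : ℝ) 1) = 1 := by
    rw [Real.dimH_of_nonempty_interior (by simp)]
    simp
  have h5 := (dimH_mono himg).trans (hH.dimH_image_le hs)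
  rw [hone, ENNReal.le_div_iff_mul_le (by simp [hs.ne']) (by simp), one_mul] at h5
  refine h5.trans (dimH_mono ?_)
  rintro _ ⟨t, -, rfl⟩
  exact mem_range_self _

end Coding

section LimitSet

open scoped Topology

variable {M : ℕ} {w w' : List ℕ} {t t' : ℝ}

/-- An interval that contains all continued fractions with digits at most `M`. -/
def digitRange (M : ℕ) : Set ℝ := Icc (1 / ((M : ℝ) + 1)) (((M : ℝ) + 1) / (M + 2))

lemma digitRange_subset (M : ℕ) : digitRange M ⊆ Ioo 0 1 := by
  intro t ht
  have : (0 : ℝ) < M + 2 := by positivity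
  refine ⟨lt_of_lt_of_le (by positivity) ht.1, lt_of_le_of_lt ht.2 ?_⟩
  rw [div_lt_one this]; linarith

lemma branch_mem_digitRange (hw : ∀ a ∈ w, 1 ≤ a ∧ a ≤ M) (ht : t ∈ digitRange M) :
    branch w t ∈ digitRange M := by
  induction w with
  | nil => exact ht
  | cons a w ih =>
    have h := ih fun b hb => hw b (List.mem_cons_of_mem _ hb)
    have h' := digitRange_subset M h
    obtain ⟨h1, h2⟩ := hw a List.mem_cons_self
    have ha : (1 : ℝ) ≤ a := by exact_mod_cast h1
    have hM : (a : ℝ) ≤ M := by exact_mod_cast h2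
    rw [branch]
    have h3 : 0 < (a : ℝ) + branch w t := by linarith [h'.1]
    constructor
    · gcongr
      exact h'.2.le
    · have : (1 : ℝ) + 1 / (M + 1) ≤ a + branch w t := add_le_add ha h.1
      rw [div_le_div_iff₀ h3 (by positivity), one_mul]
      have h4 : ((M : ℝ) + 1) * (1 + 1 / (M + 1)) = M + 2 := by
        field_simp; ring
      rw [← h4]
      gcongr

lemma abs_one_div_sub_one_div_ge {y y' c : ℝ} (hy : 0 < y) (hy' : 0 < y') (hc : y ≤ c)
    (hc' : y' ≤ c) : |y - y'| / c ^ 2 ≤ |1 / y - 1 / y'| := by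
  rw [div_sub_div _ _ hy.ne' hy'.ne', abs_div, abs_of_pos (mul_pos hy hy'), one_mul, mul_one,
    abs_sub_comm y' y]
  gcongr
  nlinarith

/-- Branches with different digits have separated images. -/
lemma exists_gap (M n : ℕ) : ∃ δ : ℝ, 0 < δ ∧ ∀ w w' : List ℕ, w.length = n → w'.length = n →
    (∀ a ∈ w, 1 ≤ a ∧ a ≤ M) → (∀ a ∈ w', 1 ≤ a ∧ a ≤ M) → w ≠ w' →
    ∀ t ∈ digitRange M, ∀ t' ∈ digitRange M, δ ≤ |branch w t - branch w' t'| := by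
  induction n with
  | zero =>
    refine ⟨1, one_pos, fun w w' h h' _ _ hne => absurd ?_ hne⟩
    rw [List.length_eq_zero_iff.1 h, List.length_eq_zero_iff.1 h']
  | succ n ih =>
    obtain ⟨δ, hδ, h⟩ := ih
    have hu : 0 < 1 - ((M : ℝ) + 1) / (M + 2) := by
      rw [sub_pos, div_lt_one (by positivity)]; linarith
    refine ⟨min δ (1 - ((M : ℝ) + 1) / (M + 2)) / (M + 1) ^ 2, by positivity, ?_⟩
    rintro (_ | ⟨a, w⟩) (_ | ⟨a', w'⟩) hl hl' hw hw' hne t ht t' ht'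
    · exact absurd rfl hne
    · simp at hl
    · simp at hl'
    have hw1 : ∀ b ∈ w, 1 ≤ b ∧ b ≤ M := fun b hb => hw b (List.mem_cons_of_mem _ hb)
    have hw2 : ∀ b ∈ w', 1 ≤ b ∧ b ≤ M := fun b hb => hw' b (List.mem_cons_of_mem _ hb)
    have hx := branch_mem_digitRange hw1 ht
    have hx' := branch_mem_digitRange hw2 ht'
    have hx0 := digitRange_subset M hx
    have hx0' := digitRange_subset M hx'
    have ha : (a : ℝ) ≤ M := by exact_mod_cast (hw a List.mem_cons_self).2
    have ha' : (a' : ℝ) ≤ M := by exact_mod_cast (hw' a' List.mem_cons_self).2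
    have hp : (0 : ℝ) ≤ a := by positivity
    have hp' : (0 : ℝ) ≤ a' := by positivity
    refine le_trans ?_ (abs_one_div_sub_one_div_ge (c := M + 1) (by linarith [hx0.1])
      (by linarith [hx0'.1]) (by linarith [hx0.2]) (by linarith [hx0'.2]))
    gcongr
    by_cases haa : a = a'
    · subst haa
      rw [add_sub_add_left_eq_sub]
      refine (min_le_left _ _).trans (h w w' (by simpa using hl) (by simpa using hl') hw1 hw2 ?_
        t ht t' ht')
      rintro rfl
      exact hne rfl
    · refine (min_le_right _ _).trans ?_
      have h1 := hx.2
      have h2 := hx'.2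
      rcases lt_or_gt_of_ne haa with hlt | hlt
      · have : (a : ℝ) + 1 ≤ a' := by exact_mod_cast hlt
        rw [abs_sub_comm]
        exact le_trans (by linarith [hx0'.1]) (le_abs_self _)
      · have : (a' : ℝ) + 1 ≤ a := by exact_mod_cast hlt
        exact le_trans (by linarith [hx0.1]) (le_abs_self _)

/-- Infinite concatenations of blocks define points. -/
lemma exists_coding (hM : 1 ≤ M) {W : Finset (List ℕ)} (hlen : ∀ w ∈ W, 2 ≤ w.length)
    (hW : ∀ w ∈ W, ∀ a ∈ w, 1 ≤ a ∧ a ≤ M) : ∃ X : (ℕ → W) → ℝ, ∀ ω,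
      X ω ∈ digitRange M ∧ X ω = branch (ω 0) (X fun i => ω (i + 1)) := by
  have hcon : ∀ w ∈ W, ∀ s ∈ digitRange M, ∀ t ∈ digitRange M,
      |branch w s - branch w t| ≤ 1 / 2 * |s - t| := by
    intro w hw s hs t ht
    obtain ⟨h1, h2, h3⟩ := branch_bounds fun a ha => (hW w hw a ha).1
    refine (h3 s (Ioo_subset_Icc_self (digitRange_subset M hs)) t
      (Ioo_subset_Icc_self (digitRange_subset M ht))).2.trans ?_
    have : (2 : ℝ) ≤ w.length := by exact_mod_cast hlen w hw
    have h4 : cylLength w * 2 ^ 2 ≤ cylLength w * w.length ^ 2 := by gcongr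
    gcongr
    linarith
  set t₀ : ℝ := 1 / ((M : ℝ) + 1)
  have ht₀ : t₀ ∈ digitRange M := by
    refine ⟨le_rfl, ?_⟩
    rw [div_le_div_iff₀ (by positivity) (by positivity)]
    have : (1 : ℝ) ≤ M := by exact_mod_cast hM
    nlinarith
  set Y : ℕ → (ℕ → W) → ℝ := fun k =>
    k.rec (fun _ => t₀) fun _ Z ω => branch (ω 0) (Z fun i => ω (i + 1))
  have hYs (k : ℕ) (ω : ℕ → W) : Y (k + 1) ω = branch (ω 0) (Y k fun i => ω (i + 1)) := rfl
  have hYm : ∀ k ω, Y k ω ∈ digitRange M := by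
    intro k
    induction k with
    | zero => exact fun _ => ht₀
    | succ k ih => exact fun ω => branch_mem_digitRange (hW _ (ω 0).2) (ih _)
  have hYd : ∀ k ω, dist (Y k ω) (Y (k + 1) ω) ≤ 1 * (1 / 2) ^ k := by
    intro k
    induction k with
    | zero =>
      intro ω
      have h1 := digitRange_subset M (hYm 0 ω)
      have h2 := digitRange_subset M (hYm 1 ω)
      rw [Real.dist_eq, abs_le]
      constructor <;> norm_num <;> linarith [h1.1, h1.2, h2.1, h2.2]
    | succ k ih =>
      intro ω
      rw [hYs k, hYs (k + 1), Real.dist_eq]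
      refine (hcon _ (ω 0).2 _ (hYm k fun i => ω (i + 1)) _ (hYm (k + 1) fun i => ω (i + 1))).trans ?_
      have := ih fun i => ω (i + 1)
      rw [Real.dist_eq] at this
      rw [pow_succ]
      linarith
  have hlim (ω : ℕ → W) : ∃ x, Tendsto (fun k => Y k ω) atTop (𝓝 x) :=
    cauchySeq_tendsto_of_complete
      (cauchySeq_of_le_geometric (1 / 2) 1 (by norm_num) fun k => hYd k ω)
  choose X hX using hlim
  have hXm (ω : ℕ → W) : X ω ∈ digitRange M :=
    isClosed_Icc.mem_of_tendsto (hX ω) (.of_forall fun k => hYm k ω)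
  refine ⟨X, fun ω => ⟨hXm ω, tendsto_nhds_unique ((tendsto_add_atTop_iff_nat 1).2 (hX ω)) ?_⟩⟩
  have hsub : digitRange M ⊆ Icc 0 1 := (digitRange_subset M).trans Ioo_subset_Icc_self
  have hc := (continuousOn_branch fun a ha => (hW _ (ω 0).2 a ha).1).mono hsub
  exact (hc _ (hXm _)).tendsto.comp
    (tendsto_nhdsWithin_iff.2 ⟨hX fun i => ω (i + 1), .of_forall fun k => hYm k _⟩)

/-- Codes that differ early belong to distant points. -/
lemma coding_separated {n : ℕ} {W : Finset (List ℕ)} (hlen : ∀ w ∈ W, w.length = n)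
    (hW : ∀ w ∈ W, ∀ a ∈ w, 1 ≤ a ∧ a ≤ M) {X : (ℕ → W) → ℝ}
    (hX : ∀ ω, X ω ∈ digitRange M ∧ X ω = branch (ω 0) (X fun i => ω (i + 1))) :
    ∃ c : ℝ, 0 < c ∧ ∀ ω ω' k, (∀ i < k, ω i = ω' i) → ω k ≠ ω' k →
      c * ∏ i ∈ Finset.range k, cylLength (ω i : List ℕ) / 2 ≤ |X ω - X ω'| := by
  obtain ⟨δ, hδ, h⟩ := exists_gap M n
  refine ⟨δ, hδ, fun ω ω' k => ?_⟩
  induction k generalizing ω ω' with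
  | zero =>
    intro _ hne
    rw [(hX ω).2, (hX ω').2]
    simpa using h _ _ (hlen _ (ω 0).2) (hlen _ (ω' 0).2) (hW _ (ω 0).2) (hW _ (ω' 0).2)
      (fun he => hne (Subtype.ext he)) _ (hX _).1 _ (hX _).1
  | succ k ih =>
    intro hlt hne
    have := ih (fun i => ω (i + 1)) (fun i => ω' (i + 1)) (fun i hi => hlt _ (by omega)) hne
    obtain ⟨h1, h2, h3⟩ := branch_bounds fun a ha => (hW _ (ω 0).2 a ha).1
    rw [(hX ω).2, (hX ω').2, ← hlt 0 (by omega)]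
    refine le_trans ?_ (h3 _ (Ioo_subset_Icc_self (digitRange_subset M (hX _).1)) _
      (Ioo_subset_Icc_self (digitRange_subset M (hX _).1))).1
    rw [Finset.prod_range_succ']
    calc _ = cylLength (ω 0 : List ℕ) / 2 *
        (δ * ∏ i ∈ Finset.range k, cylLength (ω (i + 1) : List ℕ) / 2) := by ring
      _ ≤ _ := by gcongr

end LimitSet

section Alphabet

open scoped Topology NNReal

lemma cylLength_pos {w : List ℕ} (hw : ∀ a ∈ w, 1 ≤ a) : 0 < cylLength w := (branch_bounds hw).1

lemma cylLength_le {w : List ℕ} (hw : ∀ a ∈ w, 1 ≤ a) (hne : w ≠ []) :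
    cylLength w ≤ 1 / (w.length : ℝ) ^ 2 := by
  have : (0 : ℝ) < w.length := by exact_mod_cast List.length_pos_iff.2 hne
  rw [le_div_iff₀ (by positivity)]
  exact (branch_bounds hw).2.1

/-- The cylinders of a given order have total length bounded below. -/
lemma exists_finset_sum_cylLength (n : ℕ) : ∃ F : Finset (List ℕ),
    (∀ w ∈ F, w.length = n ∧ ∀ a ∈ w, 1 ≤ a) ∧ 1 / 8 ≤ ∑ w ∈ F, cylLength w := by
  classical
  set P : Type := {w : List ℕ // w.length = n ∧ ∀ a ∈ w, 1 ≤ a}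
  have hcov : Ioo (0 : ℝ) 1 ⊆ range ((↑) : ℚ → ℝ) ∪
      ⋃ w : P, Metric.closedBall (branch w.1 0) (2 * cylLength w.1) := by
    intro x hx
    by_cases hirr : Irrational x
    · obtain ⟨w, h1, h2, h3⟩ := exists_branch_eq hirr hx n
      refine Or.inr (mem_iUnion.2 ⟨⟨w, h1, h2⟩, ?_⟩)
      have ht := gauss_iterate_irrational hirr n
      have ht' : gauss^[n] x ∈ Icc (0 : ℝ) 1 := by
        cases n with
        | zero => exact Ioo_subset_Icc_self hx
        | succ n =>
          rw [Function.iterate_succ_apply']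
          exact Ioo_subset_Icc_self (gauss_mem_Ioo (gauss_iterate_irrational hirr n))
      have hb := ((branch_bounds h2).2.2 _ ht' 0 (by simp)).2
      rw [h3, sub_zero, abs_of_nonneg ht'.1] at hb
      rw [Metric.mem_closedBall, Real.dist_eq]
      have := cylLength_pos h2
      have := ht'.2
      nlinarith
    · exact Or.inl (by simpa [Irrational] using hirr)
  have h1 := (measure_mono (μ := volume) hcov).trans (measure_union_le _ _)
  rw [(countable_range _).measure_zero, zero_add, Real.volume_Ioo] at h1
  have h2 := h1.trans (measure_iUnion_le _)
  simp only [Real.volume_closedBall, sub_zero, ENNReal.ofReal_one] at h2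
  have h3 : (2 : ℝ≥0∞)⁻¹ < ∑' w : P, ENNReal.ofReal (2 * (2 * cylLength w.1)) :=
    lt_of_lt_of_le ENNReal.one_half_lt_one h2
  rw [ENNReal.tsum_eq_iSup_sum, lt_iSup_iff] at h3
  obtain ⟨F, hF⟩ := h3
  refine ⟨F.map (Function.Embedding.subtype _), ?_, ?_⟩
  · intro w hw
    obtain ⟨v, -, rfl⟩ := Finset.mem_map.1 hw
    exact v.2
  · rw [Finset.sum_map]
    rw [← ENNReal.ofReal_sum_of_nonneg fun w _ => by
      have := cylLength_pos w.2.2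
      positivity] at hF
    rw [show (2 : ℝ≥0∞)⁻¹ = ENNReal.ofReal 2⁻¹ by
      rw [ENNReal.ofReal_inv_of_pos two_pos, ENNReal.ofReal_ofNat]] at hF
    have := (ENNReal.ofReal_lt_ofReal_iff_of_nonneg (by norm_num)).1 hF
    rw [← Finset.mul_sum, ← Finset.mul_sum] at this
    simp only [Function.Embedding.subtype_apply]
    linarith

/-- Finitely many blocks, none of them constant equal to one, of almost full dimension. -/
lemma exists_alphabet {s : ℝ≥0} (hs : s < 1) : ∃ (n M : ℕ) (W : Finset (List ℕ)), 2 ≤ n ∧ 1 ≤ M ∧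
    (∀ w ∈ W, w.length = n) ∧ (∀ w ∈ W, ∀ a ∈ w, 1 ≤ a ∧ a ≤ M) ∧
    (∀ w ∈ W, w ≠ List.replicate n 1) ∧ 1 ≤ ∑ w : W, (cylLength (w : List ℕ) / 2) ^ (s : ℝ) := by
  classical
  have hs' : (0 : ℝ) < 1 - s := sub_pos.2 (by exact_mod_cast hs)
  have hlim := (tendsto_rpow_atTop hs').comp tendsto_natCast_atTop_atTop
  obtain ⟨n, hn1, hn2⟩ := ((hlim.eventually_ge_atTop 32).and (eventually_ge_atTop 4)).exists
  simp only [Function.comp_apply] at hn1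
  have hn4 : (4 : ℝ) ≤ n := by exact_mod_cast hn2
  obtain ⟨F, hF, hsum⟩ := exists_finset_sum_cylLength n
  set W := F.erase (List.replicate n 1)
  have hW : ∀ w ∈ W, w.length = n ∧ ∀ a ∈ w, 1 ≤ a := fun w hw => hF w (Finset.mem_of_mem_erase hw)
  have hle : ∀ w : List ℕ, w.length = n → (∀ a ∈ w, 1 ≤ a) → cylLength w ≤ 1 / (n : ℝ) ^ 2 := by
    intro w h1 h2
    have := cylLength_le h2 (by rintro rfl; simp at h1; omega)
    rwa [h1] at this
  have hWs : 1 / 16 ≤ ∑ w ∈ W, cylLength w := by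
    have h1 : ∑ w ∈ F, cylLength w ≤ cylLength (List.replicate n 1) + ∑ w ∈ W, cylLength w := by
      by_cases hm : List.replicate n 1 ∈ F
      · rw [Finset.add_sum_erase _ _ hm]
      · rw [show W = F from Finset.erase_eq_of_notMem hm]
        linarith [cylLength_pos (w := List.replicate n 1)
          fun a ha => (List.eq_of_mem_replicate ha).ge]
    have h2 := hle (List.replicate n 1) (by simp) fun a ha => (List.eq_of_mem_replicate ha).ge
    have h3 : 1 / (n : ℝ) ^ 2 ≤ 1 / 4 ^ 2 := by gcongr
    norm_num at h3
    norm_num at h2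
    linarith
  refine ⟨n, 1 + ∑ w ∈ W, w.sum, W, by omega, by omega, fun w hw => (hW w hw).1,
    fun w hw a ha => ⟨(hW w hw).2 a ha, ?_⟩, fun w hw => Finset.ne_of_mem_erase hw, ?_⟩
  · have h1 := List.le_sum_of_mem ha
    have h2 := Finset.single_le_sum (f := fun w : List ℕ => w.sum) (fun _ _ => Nat.zero_le _) hw
    omega
  · rw [Finset.sum_coe_sort W fun w => (cylLength w / 2) ^ (s : ℝ)]
    have key : ∀ w ∈ W, 32 * (cylLength w / 2) ≤ (cylLength w / 2) ^ (s : ℝ) := by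
      intro w hw
      have h0 := cylLength_pos (hW w hw).2
      have h1 := hle w (hW w hw).1 (hW w hw).2
      have h2 : (cylLength w / 2) ^ (s : ℝ) =
          (cylLength w / 2)⁻¹ ^ (1 - s : ℝ) * (cylLength w / 2) := by
        rw [Real.inv_rpow (by positivity), ← Real.rpow_neg (by positivity),
          ← Real.rpow_add_one (by positivity)]
        congr 1; ring
      rw [h2]
      gcongr
      refine hn1.trans (Real.rpow_le_rpow (by positivity) ?_ hs'.le)
      rw [le_inv_comm₀ (by positivity) (by positivity)]
      have h3 : 1 / (n : ℝ) ^ 2 ≤ (n : ℝ)⁻¹ := by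
        rw [one_div]
        exact inv_anti₀ (by positivity) (by nlinarith)
      linarith
    refine le_trans ?_ (Finset.sum_le_sum key)
    rw [← Finset.mul_sum, ← Finset.sum_div]
    linarith

end Alphabet

section Ones

variable {β t v v₁ v₂ : ℝ} {k l : ℕ}

/-- The first `k` digits are equal to one. -/
def Ones (k : ℕ) (v : ℝ) : Prop := ∀ i < k, 1 / 2 < gauss^[i] v

lemma Ones.mono (h : Ones k v) (hl : l ≤ k) : Ones l v := fun i hi => h i (by omega)

lemma Ones.iterate (h : Ones (l + k) v) : Ones k (gauss^[l] v) := fun i hi => by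
  rw [← Function.iterate_add_apply]
  exact h _ (by omega)

lemma ones_succ : Ones (k + 1) v ↔ 1 / 2 < v ∧ Ones k (gauss v) := by
  refine ⟨fun h => ⟨h 0 (by omega), fun i hi => ?_⟩, fun h i hi => ?_⟩
  · rw [← Function.iterate_succ_apply]
    exact h _ (by omega)
  · cases i with
    | zero => exact h.1
    | succ i => exact h.2 i (by omega)

/-- Having only digits one is a convex condition. -/
lemma Ones.of_mem_Icc (h₁ : Ones k v₁) (h₂ : Ones k v₂) (hv₂ : v₂ < 1) (hv : v ∈ Icc v₁ v₂) :
    Ones k v := by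
  induction k generalizing v v₁ v₂ with
  | zero => exact fun i hi => absurd hi (by omega)
  | succ k ih =>
    obtain ⟨e1, h1⟩ := ones_succ.1 h₁
    obtain ⟨e2, h2⟩ := ones_succ.1 h₂
    have e3 : 1 / 2 < v := e1.trans_le hv.1
    refine ones_succ.2 ⟨e3, ih h2 h1 (Int.fract_lt_one _) ?_⟩
    rw [gauss_sub_one e1 (by linarith [hv.1, hv.2]), gauss_sub_one e2 hv₂,
      gauss_sub_one e3 (by linarith [hv.2])]
    constructor
    · gcongr
      exact hv.2
    · gcongr
      exact hv.1

lemma Ones.eq_replicate {w : List ℕ} (hw : ∀ a ∈ w, 1 ≤ a) (ht : t ∈ Ioo (0 : ℝ) 1)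
    (h : Ones w.length (branch w t)) : w = List.replicate w.length 1 := by
  induction w with
  | nil => rfl
  | cons a w ih =>
    have hw' : ∀ b ∈ w, 1 ≤ b := fun b hb => hw b (List.mem_cons_of_mem _ hb)
    obtain ⟨h1, h2⟩ := ones_succ.1 h
    have hm := branch_mem_Ioo hw' ht
    rw [branch, gauss_one_div_add a (Ioo_subset_Ico_self hm)] at h2
    rw [List.length_cons, List.replicate_succ, ← ih hw' h2]
    have ha := hw a List.mem_cons_self
    have ha' : (1 : ℝ) ≤ a := by exact_mod_cast ha
    rw [branch, div_lt_div_iff₀ (by norm_num) (by linarith [hm.1])] at h1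
    have : (a : ℝ) < 2 := by linarith [hm.1]
    have : a < 2 := by exact_mod_cast this
    rw [show a = 1 by omega]

lemma ones_branch_replicate (ht : t ∈ Ioo (0 : ℝ) 1) (k : ℕ) :
    Ones k (branch (List.replicate k 1) t) := by
  induction k with
  | zero => exact fun i hi => absurd hi (by omega)
  | succ k ih =>
    have hm := branch_mem_Ioo (w := List.replicate k 1)
      (fun a ha => (List.eq_of_mem_replicate ha).ge) ht
    rw [List.replicate_succ, branch]
    refine ones_succ.2 ⟨?_, by rwa [gauss_one_div_add 1 (Ioo_subset_Ico_self hm)]⟩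
    rw [Nat.cast_one]
    gcongr
    · linarith [hm.1]
    · linarith [hm.2]

lemma gauss_gauss_one_sub (h0 : 1 / 3 < v) (h1 : v < 1 / 2) :
    1 / 2 < gauss (1 - v) ∧ gauss (gauss (1 - v)) = gauss v := by
  have hv : v ≠ 0 := by linarith
  have hv' : 0 < 1 - v := by linarith
  have e : gauss (1 - v) = v / (1 - v) := by
    rw [gauss_sub_one (by linarith) (by linarith)]
    field_simp
    ring
  have e1 : 1 / 2 < v / (1 - v) := by rw [lt_div_iff₀ hv']; linarith
  refine ⟨by rwa [e], ?_⟩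
  rw [e, gauss_sub_one e1 (by rw [div_lt_one hv']; linarith), gauss_sub_two h0 h1.le]
  field_simp
  ring

/-- Points in the two central intervals have long blocks of ones. -/
lemma ones_of_mem_hole (h3 : 1 / 3 < β) (h2 : β < 1 / 2) (hO : Ones k (gauss β)) :
    (v ∈ Ioo β (hole β) → v ≤ 1 / 2 ∧ Ones k (gauss v)) ∧
      (1 - v ∈ Ioo β (hole β) → Ones (k + 2) v) := by
  have hh := hole_lt_half (by linarith) h2
  have hO1 : Ones (k + 2) (1 - β) := by
    obtain ⟨e1, e2⟩ := gauss_gauss_one_sub h3 h2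
    exact ones_succ.2 ⟨by linarith, ones_succ.2 ⟨e1, by rwa [e2]⟩⟩
  have hO2 : Ones (k + 2) (1 - hole β) := by
    have hb : 0 < 2 - β := by linarith
    have e1 : 1 - hole β = 1 / (2 - β) := by
      rw [hole]; field_simp; ring
    have e2 : gauss (1 - hole β) = 1 - β := by
      rw [gauss_sub_one (by linarith) (by linarith [third_lt_hole h2]), e1, one_div_one_div]
      ring
    refine Ones.mono (ones_succ.2 ⟨by linarith, ?_⟩) (Nat.le_succ _)
    rwa [e2]
  have key : ∀ u, 1 - u ∈ Ioo β (hole β) → Ones (k + 2) u := fun u hu =>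
    hO2.of_mem_Icc hO1 (by linarith) ⟨by linarith [hu.2], by linarith [hu.1]⟩
  refine ⟨fun hv => ?_, key v⟩
  have hv2 : v < 1 / 2 := hv.2.trans hh
  have := (ones_succ.1 (ones_succ.1 (key (1 - v) (by simpa using hv))).2).2
  rw [(gauss_gauss_one_sub (h3.trans hv.1) hv2).2] at this
  exact ⟨hv2.le, this⟩

lemma golden_branch (ht : 0 ≤ t) (hg : t ^ 2 + t - 1 < 0) (n : ℕ) :
    0 < branch (List.replicate (2 * n + 1) 1) t ∧
      0 < branch (List.replicate (2 * n + 1) 1) t ^ 2 +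
        branch (List.replicate (2 * n + 1) 1) t - 1 := by
  have key (s : ℝ) (hs : 0 ≤ s) :
      (1 / (1 + s)) ^ 2 + 1 / (1 + s) - 1 = -(s ^ 2 + s - 1) / (1 + s) ^ 2 := by
    have : 1 + s ≠ 0 := by linarith
    field_simp
    ring
  induction n with
  | zero =>
    simp only [mul_zero, zero_add, List.replicate_one, branch, Nat.cast_one]
    refine ⟨by positivity, ?_⟩
    rw [key t ht]
    exact div_pos (by linarith) (by positivity)
  | succ n ih =>
    rw [show 2 * (n + 1) + 1 = (2 * n + 1) + 1 + 1 by ring, List.replicate_succ,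
      List.replicate_succ, branch, branch, Nat.cast_one]
    set s := branch (List.replicate (2 * n + 1) 1) t
    have h1 : 0 < 1 / (1 + s) := by have := ih.1; positivity
    refine ⟨by positivity, ?_⟩
    rw [key _ h1.le, key s ih.1.le]
    have h2 : 0 < (s ^ 2 + s - 1) / (1 + s) ^ 2 := div_pos ih.2 (by have := ih.1; positivity)
    rw [neg_div, neg_div, neg_div, neg_neg]
    positivity

/-- The digits of the constructed parameters, followed by digits without long blocks of ones. -/
def leadingDigits (k : ℕ) : List ℕ := 2 :: (List.replicate k 1 ++ [2])

lemma one_le_of_mem_leadingDigits (k : ℕ) : ∀ a ∈ leadingDigits k, 1 ≤ a := by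
  simp only [leadingDigits, List.mem_cons, List.mem_append, List.mem_replicate]
  rintro a (rfl | ⟨-, rfl⟩ | rfl | h) <;> simp_all

lemma branch_two_lt_half (ht : 0 < t) : branch [2] t < 1 / 2 := by
  simp only [branch, Nat.cast_ofNat]
  gcongr
  linarith

lemma gauss_branch_leadingDigits (ht : t ∈ Ioo (0 : ℝ) 1) :
    gauss (branch (leadingDigits k) t) = branch (List.replicate k 1) (branch [2] t) := by
  have h2 := branch_mem_Ioo (w := [2]) (by simp) ht
  have h := branch_mem_Ioo (w := List.replicate k 1)
      (fun a ha => (List.eq_of_mem_replicate ha).ge) h2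
  rw [leadingDigits, branch, branch_append, gauss_one_div_add 2 (Ioo_subset_Ico_self h)]

/-- The orbit of a constructed parameter never has long blocks of ones again. -/
lemma not_ones_orbit (ht : t ∈ Ioo (0 : ℝ) 1) (hX : ∀ j, ¬ Ones k (gauss^[j] t)) {m : ℕ}
    (hm : 1 ≤ m) :
    ¬ Ones (k + 2) (gauss^[m] (branch (leadingDigits k) t)) ∧
      ¬ (gauss^[m] (branch (leadingDigits k) t) ≤ 1 / 2 ∧
        Ones k (gauss (gauss^[m] (branch (leadingDigits k) t)))) := by
  have h2 := branch_mem_Ioo (w := [2]) (by simp) ht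
  have h2' := branch_two_lt_half ht.1
  have hpos (l : ℕ) : ∀ a ∈ List.replicate l 1, 1 ≤ a :=
    fun a ha => (List.eq_of_mem_replicate ha).ge
  have hg2 : gauss (branch [2] t) = t := by
    simp only [branch]
    exact gauss_one_div_add 2 (Ioo_subset_Ico_self ht)
  obtain ⟨i, rfl⟩ := Nat.exists_eq_add_of_le' hm
  rw [Function.iterate_succ_apply, gauss_branch_leadingDigits ht]
  have hfull : gauss^[k] (branch (List.replicate k 1) (branch [2] t)) = branch [2] t := by
    simpa using gauss_iterate_branch (hpos k) h2
  rcases lt_trichotomy i k with hi | rfl | hi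
  · obtain ⟨l, rfl⟩ := Nat.exists_eq_add_of_lt hi
    have e : gauss^[i] (branch (List.replicate (i + l + 1) 1) (branch [2] t)) =
        branch (List.replicate (l + 1) 1) (branch [2] t) := by
      rw [add_assoc, List.replicate_add, branch_append]
      simpa using gauss_iterate_branch (hpos i) (branch_mem_Ioo (hpos (l + 1)) h2)
    rw [e]
    constructor
    · intro h
      have h3 := h (l + 1) (by omega)
      have h4 : gauss^[l + 1] (branch (List.replicate (l + 1) 1) (branch [2] t)) = branch [2] t := by
        simpa using gauss_iterate_branch (hpos (l + 1)) h2
      rw [h4] at h3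
      linarith
    · intro h
      have h3 := ones_branch_replicate h2 (l + 1) 0 (by omega)
      exact absurd h.1 (not_le.2 h3)
  · rw [hfull]
    constructor
    · intro h
      have := h 0 (by omega)
      simp only [Function.iterate_zero, id_eq] at this
      linarith
    · intro h
      rw [hg2] at h
      exact hX 0 h.2
  · obtain ⟨l, rfl⟩ := Nat.exists_eq_add_of_lt hi
    rw [show k + l + 1 = (l + 1) + k by ring, Function.iterate_add_apply, hfull,
      Function.iterate_succ_apply, hg2]
    constructor
    · exact fun h => hX l (h.mono (by omega))
    · rw [← Function.iterate_succ_apply' gauss]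
      exact fun h => hX (l + 1) h.2

lemma not_merges_leadingDigits {n : ℕ} (ht : t ∈ Ioo (0 : ℝ) 1)
    (hX : ∀ j, ¬ Ones (2 * n + 1) (gauss^[j] t))
    (hN : NonQuadratic (1 - branch (leadingDigits (2 * n + 1)) t)) :
    ¬ Merges (1 - branch (leadingDigits (2 * n + 1)) t) := by
  have h2 := branch_mem_Ioo (w := [2]) (by simp) ht
  have h2' := branch_two_lt_half ht.1
  have hγ := branch_mem_Ioo (w := List.replicate (2 * n + 1) 1)
    (fun a ha => (List.eq_of_mem_replicate ha).ge) h2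
  obtain ⟨-, hg⟩ := golden_branch h2.1.le (by nlinarith [h2.1]) n
  have hO : Ones (2 * n + 1) (gauss (branch (leadingDigits (2 * n + 1)) t)) := by
    rw [gauss_branch_leadingDigits ht]
    exact ones_branch_replicate h2 _
  have hβ : branch (leadingDigits (2 * n + 1)) t =
      1 / (2 + branch (List.replicate (2 * n + 1) 1) (branch [2] t)) := by
    rw [leadingDigits, branch, branch_append, Nat.cast_ofNat]
  set β := branch (leadingDigits (2 * n + 1)) t with hβdef
  set γ := branch (List.replicate (2 * n + 1) 1) (branch [2] t)
  have hγ2 : 0 < 2 + γ := by linarith [hγ.1]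
  have hlt3 : 1 / 3 < β := by
    rw [hβ]; gcongr; linarith [hγ.2]
  have hlt2 : β < 1 / 2 := by
    rw [hβ]; gcongr; linarith [hγ.1]
  have hq : 0 < β ^ 2 - 3 * β + 1 := by
    have : β ^ 2 - 3 * β + 1 = (γ ^ 2 + γ - 1) / (2 + γ) ^ 2 := by
      rw [hβ]; field_simp; ring
    rw [this]
    positivity
  refine not_merges_of_gauss hN (by linarith) hq hlt2 fun m hm => ?_
  obtain ⟨e1, e2⟩ := not_ones_orbit ht hX hm
  obtain ⟨e3, e4⟩ := ones_of_mem_hole (v := gauss^[m] β) hlt3 hlt2 hO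
  exact ⟨fun h => e2 (e3 h), fun h => e1 (e4 h)⟩

lemma not_ones_coding {M n : ℕ} {W : Finset (List ℕ)} (hn : 1 ≤ n) (hlen : ∀ w ∈ W, w.length = n)
    (hW : ∀ w ∈ W, ∀ a ∈ w, 1 ≤ a ∧ a ≤ M) (hne : ∀ w ∈ W, w ≠ List.replicate n 1)
    {X : (ℕ → W) → ℝ}
    (hX : ∀ ω, X ω ∈ digitRange M ∧ X ω = branch (ω 0) (X fun i => ω (i + 1)))
    (ω : ℕ → W) (j : ℕ) : ¬ Ones (2 * n + 1) (gauss^[j] (X ω)) := by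
  have hpos (ω : ℕ → W) : ∀ a ∈ (ω 0 : List ℕ), 1 ≤ a := fun a ha => (hW _ (ω 0).2 a ha).1
  have hshift (ω : ℕ → W) : gauss^[n] (X ω) = X fun i => ω (i + 1) := by
    rw [(hX ω).2, ← hlen _ (ω 0).2]
    exact gauss_iterate_branch (hpos ω) (digitRange_subset M (hX _).1)
  have hiter (q : ℕ) : ∀ ω, gauss^[n * q] (X ω) ∈ range X := by
    induction q with
    | zero => exact fun ω => ⟨ω, rfl⟩
    | succ q ih =>
      intro ω
      rw [mul_add, mul_one, Function.iterate_add_apply, hshift]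
      exact ih _
  intro h
  have hmod := Nat.div_add_mod j n
  have hlt := Nat.mod_lt j hn
  obtain ⟨ω', hω'⟩ := hiter (j / n + 1) ω
  have h1 : Ones n (gauss^[n - j % n] (gauss^[j] (X ω))) :=
    (h.mono (by omega : (n - j % n) + n ≤ 2 * n + 1)).iterate
  rw [← Function.iterate_add_apply, show n - j % n + j = n * (j / n + 1) by
    rw [mul_add]; omega, ← hω', (hX ω').2] at h1
  refine hne _ (ω' 0).2 ?_
  rw [← hlen _ (ω' 0).2] at h1 ⊢
  exact h1.eq_replicate (hpos ω') (digitRange_subset M (hX _).1)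

end Ones

section Dimension

open scoped NNReal

lemma le_dimH_E {s : ℝ≥0} (hs0 : 0 < s) (hs : s < 1) : (s : ℝ≥0∞) ≤ dimH E := by
  obtain ⟨n, M, W, hn, hM, hlen, hW, hne, hsum⟩ := exists_alphabet hs
  obtain ⟨X, hX⟩ := exists_coding hM (fun w hw => hn.trans (hlen w hw).ge) hW
  obtain ⟨c, hc, hsep⟩ := coding_separated hlen hW hX
  have hXm (ω : ℕ → W) : X ω ∈ Ioo (0 : ℝ) 1 := digitRange_subset M (hX ω).1
  set u := leadingDigits (2 * n + 1)
  have hu : ∀ a ∈ u, 1 ≤ a := one_le_of_mem_leadingDigits _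
  obtain ⟨hu0, -, hub⟩ := branch_bounds hu
  have hW' (w : W) : ∀ a ∈ (w : List ℕ), 1 ≤ a := fun a ha => (hW w w.2 a ha).1
  have hdim : (s : ℝ≥0∞) ≤ dimH (range fun ω => 1 - branch u (X ω)) := by
    refine le_dimH_range (ρ := fun w : W => cylLength (w : List ℕ) / 2) (c := cylLength u / 2 * c)
      (fun w => half_pos (cylLength_pos (hW' w))) (fun w => ?_) hs0 hsum (by positivity) ?_
    · have h1 := (branch_bounds (hW' w)).2.1
      have h2 : (1 : ℝ) ≤ (w : List ℕ).length := by
        rw [hlen w w.2]; exact_mod_cast (by omega : 1 ≤ n)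
      have h3 := cylLength_pos (hW' w)
      have h4 : cylLength (w : List ℕ) * 1 ^ 2 ≤ cylLength (w : List ℕ) *
          ((w : List ℕ).length : ℝ) ^ 2 := by gcongr
      linarith
    · intro ω ω' k hlt hk
      rw [sub_sub_sub_cancel_left, abs_sub_comm, mul_assoc]
      refine le_trans ?_ (hub _ (Ioo_subset_Icc_self (hXm ω)) _ (Ioo_subset_Icc_self (hXm ω'))).1
      exact mul_le_mul_of_nonneg_left (hsep ω ω' k hlt hk) (by positivity)
  have hsub : (range fun ω => 1 - branch u (X ω)) ⊆ E ∪ {α | ¬ NonQuadratic α} := by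
    rintro _ ⟨ω, rfl⟩
    by_cases hN : NonQuadratic (1 - branch u (X ω))
    · have hm := branch_mem_Ioo hu (hXm ω)
      refine Or.inl ⟨⟨by linarith [hm.2], by linarith [hm.1]⟩, fun h => ?_⟩
      exact not_merges_leadingDigits (hXm ω)
        (not_ones_coding (by omega) hlen hW hne hX ω) hN (Merges.of_mem_matchingSet h)
    · exact Or.inr hN
  have h := hdim.trans (dimH_mono hsub)
  rwa [dimH_union, dimH_countable countable_not_nonQuadratic, max_eq_left zero_le] at h

lemma dimH_E : dimH E = 1 := by
  refine le_antisymm ((dimH_mono (subset_univ E)).trans Real.dimH_univ.le)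
    (ENNReal.le_of_forall_nnreal_lt fun s hs => ?_)
  rcases eq_or_lt_of_le (zero_le : 0 ≤ s) with h | h
  · simp [← h]
  · exact le_dimH_E h (by exact_mod_cast hs)

end Dimension

end TanakaIto

theorem stmt10 : volume E = 0 ∧ dimH E = 1 :=
  ⟨TanakaIto.volume_E, TanakaIto.dimH_E⟩
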